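/- arXiv:1305.7495 — 2 statements merged into one kernel-verified Lean document; each statement's English description precedes it below -/
import Mathlib

section
/- Let A be a separable C*-algebra with no K₁-obstructions, and let X be a compact metric space of covering dimension one. Then C(X,A) has stable rank one. -/
noncomputable section

set_option maxHeartbeats 1000000

def StableRankOne (A : Type*) [NonUnitalCStarAlgebra A] : Prop :=
  Dense {x : Unitization ℂ A | IsUnit x}

def K1Trivial (B : Type*) [NonUnitalCStarAlgebra B] : Prop :=
  ∀ n : ℕ, 0 < n → ∀ u : unitary (Matrix (Fin n) (Fin n) (Unitization ℂ B)),
    ∃ (k : ℕ) (h : Matrix.fromBlocks u.1 0 0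
        (1 : Matrix (Fin k) (Fin k) (Unitization ℂ B)) ∈
        unitary (Matrix (Fin n ⊕ Fin k) (Fin n ⊕ Fin k) (Unitization ℂ B))),
      Joined (1 : unitary (Matrix (Fin n ⊕ Fin k) (Fin n ⊕ Fin k) (Unitization ℂ B)))
        ⟨Matrix.fromBlocks u.1 0 0 1, h⟩

def NoK1Obstructions (A : Type*) [NonUnitalCStarAlgebra A] : Prop :=
  StableRankOne A ∧
    ∀ (B : NonUnitalStarSubalgebra ℂ A) [IsClosed (B : Set A)],
      (∀ b ∈ B, ∀ a : A, ∀ b' ∈ B, b * a * b' ∈ B) → K1Trivial B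

/-- Covering dimension at most `n`: every finite open cover has a finite open refinement
covering `X` in which each point lies in at most `n + 1` members. -/
def CoveringDimLE (X : Type*) [TopologicalSpace X] (n : ℕ) : Prop :=
  ∀ 𝒰 : Finset (Set X), (∀ U ∈ 𝒰, IsOpen U) → ⋃₀ (𝒰 : Set (Set X)) = Set.univ →
    ∃ 𝒱 : Finset (Set X), (∀ V ∈ 𝒱, IsOpen V) ∧ ⋃₀ (𝒱 : Set (Set X)) = Set.univ ∧
      (∀ V ∈ 𝒱, ∃ U ∈ 𝒰, V ⊆ U) ∧
      ∀ x : X, Set.ncard {V : Set X | V ∈ 𝒱 ∧ x ∈ V} ≤ n + 1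

/-- Covering dimension exactly `n`. -/
def CoveringDimEq (X : Type*) [TopologicalSpace X] (n : ℕ) : Prop :=
  CoveringDimLE X n ∧ ∀ m : ℕ, CoveringDimLE X m → n ≤ m

section Rows

open Matrix

variable {ι S : Type*} [Fintype ι] [DecidableEq ι] [Ring S]

lemma exists_units_vecMul_eq (v w δ : ι → S) (h : IsUnit (1 + δ ⬝ᵥ w)) :
    ∃ g : (Matrix ι ι S)ˣ, v ᵥ* g.1 = v + fun j => (v ⬝ᵥ w) * δ j := by
  obtain ⟨c, hc⟩ := h
  have key : ∀ a b : S, vecMulVec w (fun j => a * δ j) * vecMulVec w (fun j => b * δ j) =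
      vecMulVec w (fun j => a * (δ ⬝ᵥ w) * b * δ j) := by
    intro a b
    ext i j
    simp only [Matrix.mul_apply, vecMulVec_apply, dotProduct, Finset.sum_mul, Finset.mul_sum,
      mul_assoc]
  have h1 : vecMulVec w δ = vecMulVec w (fun j => 1 * δ j) := by simp
  have hA : (δ ⬝ᵥ w) = c.1 - 1 := by rw [hc]; abel
  refine ⟨⟨1 + vecMulVec w δ, 1 - vecMulVec w (fun j => c⁻¹.1 * δ j), ?_, ?_⟩, ?_⟩
  · have : vecMulVec w δ * vecMulVec w (fun j => c⁻¹.1 * δ j) =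
        vecMulVec w δ - vecMulVec w (fun j => c⁻¹.1 * δ j) := by
      rw [h1, key, hA]
      ext i j
      simp [vecMulVec_apply, sub_mul, mul_sub]
    simp only [mul_sub, add_mul, one_mul, mul_one, this]; abel
  · have : vecMulVec w (fun j => c⁻¹.1 * δ j) * vecMulVec w δ =
        vecMulVec w δ - vecMulVec w (fun j => c⁻¹.1 * δ j) := by
      rw [h1, key, hA]
      ext i j
      simp [vecMulVec_apply, sub_mul, mul_sub]
    simp only [sub_mul, mul_add, one_mul, mul_one, this]; abel
  · ext j
    simp only [vecMul_add, vecMul_one, Pi.add_apply, add_right_inj]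
    simp only [vecMul, dotProduct, vecMulVec_apply, Finset.sum_mul, mul_assoc]

/-- Two rows are equivalent if an invertible matrix carries one to the other. -/
def RowEquiv (v v' : ι → S) : Prop := ∃ g : (Matrix ι ι S)ˣ, v ᵥ* g.1 = v'

/-- A row is unimodular if its entries generate the unit right ideal. -/
def UnimodularRow (v : ι → S) : Prop := ∃ w : ι → S, v ⬝ᵥ w = 1

lemma RowEquiv.trans {v v' v'' : ι → S} (h : RowEquiv v v') (h' : RowEquiv v' v'') :
    RowEquiv v v'' := by
  obtain ⟨g, rfl⟩ := h
  obtain ⟨g', rfl⟩ := h'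
  exact ⟨g * g', by simp [vecMul_vecMul]⟩

lemma UnimodularRow.of_rowEquiv {v v' : ι → S} (hv : UnimodularRow v) (h : RowEquiv v v') :
    UnimodularRow v' := by
  obtain ⟨w, hw⟩ := hv
  obtain ⟨g, rfl⟩ := h
  refine ⟨g⁻¹.1 *ᵥ w, ?_⟩
  rw [dotProduct_mulVec, vecMul_vecMul]
  simpa using hw

lemma rowEquiv_add_mul_of_apply_eq_zero (v δ : ι → S) (i : ι) (h : δ i = 0) :
    RowEquiv v (v + fun j => v i * δ j) := by
  have := exists_units_vecMul_eq v (Pi.single i 1) δ (by simp [h])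
  simpa [RowEquiv] using this

end Rows

section Banach

open Matrix

variable {ι S : Type*} [Fintype ι] [DecidableEq ι] [NormedRing S] [CompleteSpace S]

lemma UnimodularRow.exists_rowEquiv_of_norm_lt {v : ι → S} (hv : UnimodularRow v) :
    ∃ η > 0, ∀ v' : ι → S, (∀ i, ‖v' i - v i‖ < η) → RowEquiv v v' := by
  obtain ⟨w, hw⟩ := hv
  set K : ℝ := ∑ i, ‖w i‖
  have hK : 0 ≤ K := Finset.sum_nonneg fun _ _ => norm_nonneg _
  refine ⟨1 / (K + 1), by positivity, fun v' h => ?_⟩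
  have hsmall : ‖(v' - v) ⬝ᵥ w‖ < 1 := by
    calc ‖(v' - v) ⬝ᵥ w‖ ≤ ∑ i, ‖(v' - v) i * w i‖ := norm_sum_le _ _
      _ ≤ ∑ i, 1 / (K + 1) * ‖w i‖ := by
          gcongr with i
          exact (norm_mul_le _ _).trans (by gcongr; exact (h i).le)
      _ = K / (K + 1) := by rw [← Finset.mul_sum]; ring
      _ < 1 := by rw [div_lt_one (by positivity)]; linarith
  have hu : IsUnit (1 + (v' - v) ⬝ᵥ w) := by
    rw [← norm_neg] at hsmall
    simpa only [sub_neg_eq_add] using isUnit_one_sub_of_norm_lt_one hsmall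
  obtain ⟨g, hg⟩ := exists_units_vecMul_eq v w (v' - v) hu
  exact ⟨g, by rw [hg, hw]; ext; simp⟩

/-- Elements of `S` that are polynomials in `z` of degree at most `n` with coefficients in the
range of `C`. -/
def polyLE {R S : Type*} [Ring R] [Ring S] (C : R →+* S) (z : S) : ℕ → AddSubgroup S
  | 0 => C.toAddMonoidHom.range
  | n + 1 => polyLE C z n ⊔ ((AddMonoidHom.mulLeft (z ^ (n + 1))).comp C.toAddMonoidHom).range

section Poly

variable {R : Type*} [NormedRing R] (C : R →+* S) (z : S)

omit [CompleteSpace S] in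
lemma mem_polyLE_succ {n : ℕ} {f : S} :
    f ∈ polyLE C z (n + 1) ↔ ∃ c, ∃ q ∈ polyLE C z n, f = z ^ (n + 1) * C c + q := by
  simp only [polyLE, AddSubgroup.mem_sup, AddMonoidHom.mem_range]
  constructor
  · rintro ⟨q, hq, _, ⟨c, rfl⟩, rfl⟩
    exact ⟨c, q, hq, by simp [add_comm]⟩
  · rintro ⟨c, q, hq, rfl⟩
    exact ⟨q, hq, _, ⟨c, rfl⟩, by simp [add_comm]⟩

omit [CompleteSpace S] in
lemma mul_C_mem_polyLE {n : ℕ} {f : S} (hf : f ∈ polyLE C z n) (r : R) :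
    f * C r ∈ polyLE C z n := by
  induction n generalizing f with
  | zero =>
    obtain ⟨a, rfl⟩ := hf
    exact ⟨a * r, by simp⟩
  | succ n ih =>
    obtain ⟨c, q, hq, rfl⟩ := (mem_polyLE_succ C z).1 hf
    exact (mem_polyLE_succ C z).2 ⟨c * r, q * C r, ih hq, by simp [add_mul, mul_assoc]⟩

omit [CompleteSpace S] in
lemma polyLE_mono : Monotone (polyLE C z) := by
  refine monotone_nat_of_le_succ fun n => ?_
  exact le_sup_left

omit [CompleteSpace S] in
lemma pow_mul_C_mem_polyLE (n : ℕ) (r : R) : z ^ n * C r ∈ polyLE C z n := by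
  cases n with
  | zero => exact ⟨r, by simp⟩
  | succ n => exact (mem_polyLE_succ C z).2 ⟨r, 0, zero_mem _, by simp⟩

variable (hz : ∀ r, Commute z (C r))

include hz

omit [CompleteSpace S] in
lemma mul_mem_polyLE_succ {n : ℕ} {f : S} (hf : f ∈ polyLE C z n) :
    f * z ∈ polyLE C z (n + 1) := by
  induction n generalizing f with
  | zero =>
    obtain ⟨a, rfl⟩ := hf
    exact (mem_polyLE_succ C z).2 ⟨a, 0, zero_mem _, by simp [(hz a).eq]⟩
  | succ n ih =>
    obtain ⟨c, q, hq, rfl⟩ := (mem_polyLE_succ C z).1 hf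
    refine (mem_polyLE_succ C z).2 ⟨c, q * z, ih hq, ?_⟩
    rw [add_mul, mul_assoc, ← (hz c).eq, ← mul_assoc, ← pow_succ]

variable (hC : ∀ r, ‖C r‖ ≤ ‖r‖) (hR : ∀ (r : R) (η : ℝ), 0 < η → ∃ c : Rˣ, ‖c.1 - r‖ < η)

include hC hR

omit [CompleteSpace S] hz in
lemma exists_units_norm_pow_mul_sub_lt (n : ℕ) (r : R) {η : ℝ} (hη : 0 < η) :
    ∃ c : Rˣ, ‖z ^ n * C c - z ^ n * C r‖ < η := by
  obtain ⟨c, hc⟩ := hR r (η / (‖z ^ n‖ + 1)) (by positivity)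
  refine ⟨c, ?_⟩
  rw [← mul_sub, ← map_sub]
  rw [lt_div_iff₀ (by positivity)] at hc
  calc ‖z ^ n * C (c.1 - r)‖ ≤ ‖z ^ n‖ * ‖C (c.1 - r)‖ := norm_mul_le _ _
    _ ≤ ‖z ^ n‖ * ‖c.1 - r‖ := by gcongr; exact hC _
    _ ≤ ‖c.1 - r‖ * (‖z ^ n‖ + 1) := by nlinarith [norm_nonneg (c.1 - r)]
    _ < η := hc

omit [CompleteSpace S] in
lemma exists_polyLE_isUnit_leadingCoeff {n : ℕ} {f : S} (hf : f ∈ polyLE C z n) {η : ℝ}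
    (hη : 0 < η) :
    ∃ f' ∈ polyLE C z n, ‖f' - f‖ < η ∧ ∃ e : Rˣ, ∀ r : R,
      f' * (z * C (e⁻¹.1 * r)) - z ^ (n + 1) * C r ∈ polyLE C z n := by
  cases n with
  | zero =>
    obtain ⟨a, rfl⟩ := hf
    obtain ⟨e, he⟩ := exists_units_norm_pow_mul_sub_lt C z hC hR 0 a hη
    refine ⟨C e, ⟨e, rfl⟩, by simpa using he, e, fun r => ?_⟩
    have : C e * (z * C (e⁻¹.1 * r)) - z ^ (0 + 1) * C r = 0 := by
      rw [← mul_assoc, ← (hz _).eq, mul_assoc, ← map_mul]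
      simp
    rw [this]
    exact zero_mem _
  | succ n =>
    obtain ⟨c, q, hq, rfl⟩ := (mem_polyLE_succ C z).1 hf
    obtain ⟨e, he⟩ := exists_units_norm_pow_mul_sub_lt C z hC hR (n + 1) c hη
    refine ⟨z ^ (n + 1) * C e + q, (mem_polyLE_succ C z).2 ⟨e, q, hq, rfl⟩, by simpa using he,
      e, fun r => ?_⟩
    have : (z ^ (n + 1) * C e + q) * (z * C (e⁻¹.1 * r)) - z ^ (n + 1 + 1) * C r =
        q * z * C (e⁻¹.1 * r) := by
      have h1 : C e.1 * (z * C (e⁻¹.1 * r)) = z * C r := by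
        rw [← mul_assoc, ← (hz _).eq, mul_assoc, ← map_mul]
        simp
      rw [add_mul, mul_assoc, h1, ← mul_assoc, ← pow_succ, mul_assoc]
      abel
    rw [this]
    exact mul_C_mem_polyLE C z (mul_mem_polyLE_succ C z hz hq) _

/-- A Euclidean algorithm, made possible by perturbing leading coefficients to be invertible. -/
lemma UnimodularRow.rowEquiv_single_of_polyLE [Nontrivial ι] (l : ι) (n : ℕ) {v : ι → S}
    (hv : UnimodularRow v) (hp : ∀ i, v i ∈ polyLE C z n) :
    ∃ k : Rˣ, RowEquiv v (Pi.single l (C k)) := by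
  induction n generalizing v with
  | zero =>
    obtain ⟨η, hη, hnear⟩ := hv.exists_rowEquiv_of_norm_lt
    obtain ⟨a, ha⟩ := hp l
    obtain ⟨c, hc⟩ := exists_units_norm_pow_mul_sub_lt C z hC hR 0 a hη
    have h1 : RowEquiv v (Function.update v l (C c)) := hnear _ fun i => by
      by_cases hi : i = l
      · subst hi
        rw [← ha]
        simpa using hc
      · simp [hi, hη]
    refine ⟨c, h1.trans ?_⟩
    have h2 := rowEquiv_add_mul_of_apply_eq_zero (Function.update v l (C c))
      (fun j => if j = l then 0 else -(C c⁻¹.1 * v j)) l (by simp)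
    convert h2 using 1
    ext j
    by_cases hj : j = l
    · subst hj; simp
    · simp [hj, ← mul_assoc, ← map_mul]
  | succ n ih =>
    obtain ⟨η, hη, hnear⟩ := hv.exists_rowEquiv_of_norm_lt
    choose a q hq hvq using fun i => (mem_polyLE_succ C z).1 (hp i)
    obtain ⟨c, hc⟩ := exists_units_norm_pow_mul_sub_lt C z hC hR (n + 1) (a l) hη
    set t : S := z ^ (n + 1) * C c + q l
    have h1 : RowEquiv v (Function.update v l t) := hnear _ fun i => by
      by_cases hi : i = l
      · subst hi
        rw [hvq i]
        simpa [t] using hc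
      · simp [hi, hη]
    have h2 := rowEquiv_add_mul_of_apply_eq_zero (Function.update v l t)
      (fun j => if j = l then 0 else -(C (c⁻¹.1 * a j))) l (by simp)
    set v2 : ι → S := _ + _ with hv2
    have h12 : RowEquiv v v2 := h1.trans h2
    have hv2l : v2 l = t := by simp [hv2]
    have hv2j : ∀ j, j ≠ l → v2 j ∈ polyLE C z n := by
      intro j hj
      have : v2 j = q j - q l * C (c⁻¹.1 * a j) := by
        have h3 : z ^ (n + 1) * C c.1 * C (c⁻¹.1 * a j) = z ^ (n + 1) * C (a j) := by
          rw [mul_assoc, ← map_mul]; simp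
        simp only [hv2, Pi.add_apply, Function.update_of_ne hj, Function.update_self, if_neg hj]
        rw [hvq j, mul_neg, add_mul, h3]
        abel
      rw [this]
      exact sub_mem (hq j) (mul_C_mem_polyLE C z (hq l) _)
    have hu2 : UnimodularRow v2 := hv.of_rowEquiv h12
    obtain ⟨i₀, hi₀⟩ := exists_ne l
    obtain ⟨η', hη', hnear'⟩ := hu2.exists_rowEquiv_of_norm_lt
    obtain ⟨f, hf, hfv, e, he⟩ :=
      exists_polyLE_isUnit_leadingCoeff C z hz hC hR (hv2j i₀ hi₀) hη'
    have h3 : RowEquiv v2 (Function.update v2 i₀ f) := hnear' _ fun i => by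
      by_cases hi : i = i₀
      · subst hi
        simpa using hfv
      · simp [hi, hη']
    have h4 := rowEquiv_add_mul_of_apply_eq_zero (Function.update v2 i₀ f)
      (Pi.single l (-(z * C (e⁻¹.1 * c.1)))) i₀ (by simp [hi₀])
    set v4 : ι → S := _ + _ with hv4
    have h14 : RowEquiv v v4 := (h12.trans h3).trans h4
    obtain ⟨k, hk⟩ := ih (hv.of_rowEquiv h14) fun i => by
      by_cases hi : i = l
      · subst hi
        have : v4 i = q i - (f * (z * C (e⁻¹.1 * c.1)) - z ^ (n + 1) * C c) := by
          simp only [hv4, Pi.add_apply, Function.update_of_ne hi₀.symm, Function.update_self,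
            Pi.single_eq_same, hv2l, t]
          rw [mul_neg]
          abel
        rw [this]
        exact sub_mem (hq i) (he _)
      · by_cases hi' : i = i₀
        · subst hi'
          simpa [hv4, hi] using hf
        · simpa [hv4, hi, hi'] using hv2j i hi
    exact ⟨k, h14.trans hk⟩

end Poly

end Banach

section Approx

open Topology

variable {X E : Type*} [TopologicalSpace X] [CompactSpace X] [T2Space X]
  [NormedAddCommGroup E] [NormedSpace ℂ E]

/-- The function `x ↦ g x • e`. -/
def smulConst (g : C(X, ℂ)) (e : E) : C(X, E) := ⟨fun x => g x • e, by fun_prop⟩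

omit [T2Space X] in
lemma norm_smulConst_le (g : C(X, ℂ)) (e : E) : ‖smulConst g e‖ ≤ ‖g‖ * ‖e‖ := by
  refine (ContinuousMap.norm_le _ (by positivity)).2 fun x => ?_
  simp only [smulConst, ContinuousMap.coe_mk, norm_smul]
  gcongr
  exact g.norm_coe_le_norm x

lemma exists_sum_smulConst_norm_sub_lt (f : C(X, E)) {ε : ℝ} (hε : 0 < ε) :
    ∃ (t : Finset X) (ρ : X → C(X, ℂ)), ‖f - ∑ y ∈ t, smulConst (ρ y) (f y)‖ < ε := by
  obtain ⟨t, ht⟩ := isCompact_univ.elim_finite_subcover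
    (fun y : X => {x | ‖f x - f y‖ < ε / 2})
    (fun y => isOpen_lt (by fun_prop) continuous_const)
    (fun x _ => Set.mem_iUnion.2 ⟨x, by simpa using hε⟩)
  obtain ⟨ρ, hρ⟩ := PartitionOfUnity.exists_isSubordinate isClosed_univ
    (fun y : t => {x | ‖f x - f y‖ < ε / 2})
    (fun y => isOpen_lt (by fun_prop) continuous_const)
    (fun x hx => by simpa using ht hx)
  classical
  refine ⟨t, fun y => if h : y ∈ t then ⟨fun x => (ρ ⟨y, h⟩ x : ℂ), by fun_prop⟩ else 0, ?_⟩
  refine lt_of_le_of_lt ((ContinuousMap.norm_le _ (by positivity : 0 ≤ ε / 2)).2 fun x => ?_)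
    (half_lt_self hε)
  have hsum : ∑ y : t, ρ y x = 1 := by
    rw [← finsum_eq_sum_of_fintype]
    exact ρ.sum_eq_one (Set.mem_univ x)
  have h1 : (f - ∑ y ∈ t, smulConst (if h : y ∈ t then
      (⟨fun x => (ρ ⟨y, h⟩ x : ℂ), by fun_prop⟩ : C(X, ℂ)) else 0) (f y)) x =
      ∑ y : t, (ρ y x : ℂ) • (f x - f y) := by
    rw [← Finset.sum_coe_sort]
    simp only [smul_sub, Finset.sum_sub_distrib, ← Finset.sum_smul]
    rw [← Complex.ofReal_sum, hsum]
    simp [smulConst]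
  rw [h1]
  calc ‖∑ y : t, (ρ y x : ℂ) • (f x - f y)‖ ≤ ∑ y : t, ‖(ρ y x : ℂ) • (f x - f y)‖ :=
        norm_sum_le _ _
    _ ≤ ∑ y : t, ρ y x * (ε / 2) := by
        gcongr with y
        rw [norm_smul, Complex.norm_real, Real.norm_of_nonneg (ρ.nonneg y x)]
        by_cases h0 : ρ y x = 0
        · simp [h0]
        · gcongr
          · exact ρ.nonneg y x
          · exact (hρ y (subset_tsupport _ h0)).le
    _ = ε / 2 := by rw [← Finset.sum_mul, hsum, one_mul]

end Approx

section Circle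

open Topology

variable {R : Type*} [NormedRing R] [NormedAlgebra ℂ R]

/-- The circle `ℝ / ℤ`. -/
abbrev Circ : Type := AddCircle (1 : ℝ)

/-- Constant functions on the circle, as a ring homomorphism. -/
def constHom (R : Type*) [NormedRing R] : R →+* C(Circ, R) where
  toFun r := ContinuousMap.const _ r
  map_one' := rfl
  map_mul' _ _ := rfl
  map_zero' := rfl
  map_add' _ _ := rfl

omit [NormedAlgebra ℂ R] in
lemma norm_constHom_le (r : R) : ‖constHom R r‖ ≤ ‖r‖ :=
  (ContinuousMap.norm_le _ (norm_nonneg _)).2 fun _ => le_rfl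

/-- The function `θ ↦ exp (2 π i n θ)` on the circle, with values in `R`. -/
def fourierIn (R : Type*) [NormedRing R] [NormedAlgebra ℂ R] (n : ℤ) : C(Circ, R) :=
  smulConst (fourier n) 1

lemma fourierIn_add (m n : ℤ) : fourierIn R (m + n) = fourierIn R m * fourierIn R n := by
  ext x
  simp only [fourierIn, smulConst, ContinuousMap.coe_mk, ContinuousMap.mul_apply, fourier_add,
    smul_mul_smul_comm, one_mul]

lemma fourierIn_zero : fourierIn R 0 = 1 := by
  ext x
  simp [fourierIn, smulConst]

lemma fourierIn_one_pow (n : ℕ) : fourierIn R 1 ^ n = fourierIn R n := by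
  induction n with
  | zero => simp [fourierIn_zero]
  | succ n ih => rw [pow_succ, ih, ← fourierIn_add]; simp

lemma fourierIn_commute (n : ℤ) (f : C(Circ, R)) : Commute (fourierIn R n) f := by
  ext x
  simp [fourierIn, smulConst]

/-- Laurent polynomials on the circle with coefficients in `R`. -/
def laurent (R : Type*) [NormedRing R] [NormedAlgebra ℂ R] : AddSubgroup C(Circ, R) where
  carrier := {f | ∃ N : ℕ, ∀ n ≥ N, f * fourierIn R n ∈ polyLE (constHom R) (fourierIn R 1) (2 * n)}
  zero_mem' := ⟨0, fun n _ => by rw [zero_mul]; exact zero_mem _⟩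
  neg_mem' := by
    rintro f ⟨N, hN⟩
    exact ⟨N, fun n hn => by
      have h : -f * fourierIn R n = -(f * fourierIn R n) :=
        ContinuousMap.ext fun x => neg_mul (f x) _
      exact h ▸ neg_mem (hN n hn)⟩
  add_mem' := by
    rintro f g ⟨N, hN⟩ ⟨M, hM⟩
    refine ⟨max N M, fun n hn => ?_⟩
    rw [add_mul]
    exact add_mem (hN n (le_of_max_le_left hn)) (hM n (le_of_max_le_right hn))

lemma smulConst_fourier_mem_laurent (k : ℤ) (r : R) : smulConst (fourier k) r ∈ laurent R := by
  refine ⟨k.natAbs, fun n hn => ?_⟩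
  have h0 : 0 ≤ k + n := by omega
  have h1 : smulConst (fourier k) r * fourierIn R n =
      fourierIn R 1 ^ (k + n).toNat * constHom R r := by
    rw [fourierIn_one_pow, Int.toNat_of_nonneg h0]
    ext x
    simp [fourierIn, smulConst, smul_smul, mul_comm]
    rfl
  rw [h1]
  exact polyLE_mono _ _ (by omega) (pow_mul_C_mem_polyLE _ _ _ _)

lemma dense_laurent (f : C(Circ, R)) : f ∈ (laurent R).topologicalClosure := by
  have h0 : ∀ g ∈ Submodule.span ℂ (Set.range <| @fourier 1), ∀ r : R,
      smulConst g r ∈ laurent R := by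
    intro g hg r
    induction hg using Submodule.span_induction generalizing r with
    | mem g hg =>
      obtain ⟨k, rfl⟩ := hg
      exact smulConst_fourier_mem_laurent k r
    | zero =>
      have : smulConst (0 : C(Circ, ℂ)) r = 0 := by ext; simp [smulConst]
      rw [this]; exact zero_mem _
    | add g g' _ _ h h' =>
      have : smulConst (g + g') r = smulConst g r + smulConst g' r := by
        ext; simp [smulConst, add_smul]
      rw [this]; exact add_mem (h r) (h' r)
    | smul c g _ h =>
      have : smulConst (c • g) r = smulConst g (c • r) := by
        ext; simp [smulConst, smul_smul, mul_comm]
      rw [this]; exact h _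
  have hs : ∀ (r : R) (g : C(Circ, ℂ)), smulConst g r ∈ (laurent R).topologicalClosure := by
    intro r g
    have hg : g ∈ (Submodule.span ℂ (Set.range <| @fourier 1)).topologicalClosure := by
      rw [span_fourier_closure_eq_top]; trivial
    have hcont : Continuous fun g : C(Circ, ℂ) => smulConst g r := by
      have : LipschitzWith ‖r‖₊ fun g : C(Circ, ℂ) => smulConst g r := by
        refine LipschitzWith.of_dist_le_mul fun g g' => ?_
        rw [dist_eq_norm, dist_eq_norm]
        have : smulConst g r - smulConst g' r = smulConst (g - g') r := by
          ext x; simp [smulConst, sub_smul]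
        rw [this, mul_comm]
        exact norm_smulConst_le _ _
      exact this.continuous
    exact hcont.closure_preimage_subset _ (closure_mono (fun g hg => h0 g hg r) hg)
  refine Metric.mem_closure_iff.2 fun ε hε => ?_
  obtain ⟨t, ρ, h⟩ := exists_sum_smulConst_norm_sub_lt f (half_pos hε)
  have hmem : ∑ y ∈ t, smulConst (ρ y) (f y) ∈ (laurent R).topologicalClosure :=
    sum_mem fun y _ => hs _ _
  obtain ⟨b, hb, hd⟩ := Metric.mem_closure_iff.1 hmem _ (half_pos hε)
  refine ⟨b, hb, ?_⟩
  rw [← dist_eq_norm] at h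
  exact (dist_triangle _ _ _).trans_lt (by linarith)

end Circle

section Injectivity

open Matrix Topology

variable {R : Type*} [NormedRing R] [NormedAlgebra ℂ R] [CompleteSpace R]

lemma UnimodularRow.rowEquiv_single_constHom {ι : Type*} [Fintype ι] [DecidableEq ι] [Nontrivial ι]
    (hR : ∀ (r : R) (η : ℝ), 0 < η → ∃ c : Rˣ, ‖c.1 - r‖ < η) (l : ι) {v : ι → C(Circ, R)}
    (hv : UnimodularRow v) : ∃ k : Rˣ, RowEquiv v (Pi.single l (constHom R k)) := by
  obtain ⟨η, hη, hnear⟩ := hv.exists_rowEquiv_of_norm_lt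
  have h1 : ∀ i, ∃ b ∈ laurent R, ‖b - v i‖ < η := fun i => by
    obtain ⟨b, hb, hd⟩ := Metric.mem_closure_iff.1 (dense_laurent (v i)) η hη
    exact ⟨b, hb, by rwa [← dist_eq_norm, dist_comm]⟩
  choose b hb hbv using h1
  choose N hN using hb
  have hvb := hnear b hbv
  set n := Finset.univ.sup N
  let s : C(Circ, R)ˣ := ⟨fourierIn R n, fourierIn R (-n),
    by rw [← fourierIn_add, add_neg_cancel, fourierIn_zero],
    by rw [← fourierIn_add, neg_add_cancel, fourierIn_zero]⟩
  have hbb : RowEquiv b (fun i => b i * fourierIn R n) := by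
    refine ⟨Units.map (Matrix.scalar ι).toMonoidHom s, ?_⟩
    ext1 i
    simp [s, vecMul_diagonal]
  have h2 := hvb.trans hbb
  obtain ⟨k, hk⟩ := (hv.of_rowEquiv h2).rowEquiv_single_of_polyLE (constHom R) (fourierIn R 1)
    (fun r => fourierIn_commute 1 _) norm_constHom_le hR l (2 * n)
    fun i => hN i n (Finset.le_sup (Finset.mem_univ i))
  exact ⟨k, h2.trans hk⟩

/-- The diagonal matrix with entries `u, 1, …, 1`. -/
def diagUnit {R : Type*} [Ring R] (n : ℕ) (u : Rˣ) : (Matrix (Fin (n + 1)) (Fin (n + 1)) R)ˣ where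
  val := diagonal fun j => if j = 0 then u.1 else 1
  inv := diagonal fun j => if j = 0 then u⁻¹.1 else 1
  val_inv := by
    rw [diagonal_mul_diagonal, ← diagonal_one]
    congr 1; ext j; split_ifs <;> simp
  inv_val := by
    rw [diagonal_mul_diagonal, ← diagonal_one]
    congr 1; ext j; split_ifs <;> simp

lemma one_row {R ι : Type*} [Ring R] [DecidableEq ι] (l : ι) :
    (1 : Matrix ι ι R) l = Pi.single l 1 := by
  ext j
  simp [Matrix.one_apply, Pi.single_apply, eq_comm]

/-- The upper left block of an invertible matrix with trivial last row. -/
def cutUnit {R : Type*} [Ring R] {n : ℕ} (N : (Matrix (Fin (n + 1)) (Fin (n + 1)) R)ˣ)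
    (h : N.1 (Fin.last n) = Pi.single (Fin.last n) 1) : (Matrix (Fin n) (Fin n) R)ˣ :=
  have h' : N⁻¹.1 (Fin.last n) = Pi.single (Fin.last n) 1 := by
    have h1 := congrArg (· ᵥ* N⁻¹.1) h
    simp only [single_one_vecMul, ← mul_apply_eq_vecMul, Units.mul_inv] at h1
    exact h1.symm.trans (one_row _)
  have hmul : ∀ M M' : Matrix (Fin (n + 1)) (Fin (n + 1)) R, M * M' = 1 →
      M' (Fin.last n) = Pi.single (Fin.last n) 1 →
      M.submatrix Fin.castSucc Fin.castSucc * M'.submatrix Fin.castSucc Fin.castSucc = 1 := by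
    intro M M' hM hl
    ext i j
    have := congrFun (congrFun hM i.castSucc) j.castSucc
    rw [Matrix.mul_apply, Fin.sum_univ_castSucc, hl] at this
    simpa [Matrix.mul_apply, Matrix.one_apply, Fin.castSucc_ne_last] using this
  { val := N.1.submatrix Fin.castSucc Fin.castSucc
    inv := N⁻¹.1.submatrix Fin.castSucc Fin.castSucc
    val_inv := hmul _ _ N.mul_inv h'
    inv_val := hmul _ _ N.inv_mul h }

/-- Evaluation of an invertible matrix of functions at a point. -/
def evalUnit {n : ℕ} (g : (Matrix (Fin n) (Fin n) C(Circ, R))ˣ) (x : Circ) :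
    (Matrix (Fin n) (Fin n) R)ˣ :=
  Units.map (RingHom.mapMatrix (⟨⟨⟨fun f => f x, rfl⟩, fun _ _ => rfl⟩, rfl, fun _ _ => rfl⟩ :
    C(Circ, R) →+* R)).toMonoidHom g

omit [NormedAlgebra ℂ R] [CompleteSpace R] in
lemma continuous_evalUnit {n : ℕ} (g : (Matrix (Fin n) (Fin n) C(Circ, R))ˣ) :
    Continuous (evalUnit g) := by
  refine Units.continuous_iff.2 ⟨?_, ?_⟩ <;> refine continuous_matrix fun i j => ?_
  · exact (g.1 i j).continuous
  · exact (g⁻¹.1 i j).continuous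

lemma joined_diagUnit_of_succ (hR : ∀ (r : R) (η : ℝ), 0 < η → ∃ c : Rˣ, ‖c.1 - r‖ < η) (n : ℕ)
    (u : Rˣ) (h : Joined 1 (diagUnit (n + 1) u)) : Joined 1 (diagUnit n u) := by
  obtain ⟨γ⟩ := h
  set l := Fin.last (n + 1)
  have hl0 : l ≠ 0 := (Fin.last_pos).ne'
  have hγ : Continuous fun t : ℝ => γ.extend t := γ.continuous_extend
  obtain ⟨hγ1, hγ2⟩ := Units.continuous_iff.1 hγ
  have e0 : γ.extend 0 = 1 := γ.extend_zero
  have e1 : γ.extend 1 = diagUnit (n + 1) u := γ.extend_one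
  have lift : ∀ f : ℝ → R, Continuous f → f 0 = f 1 →
      ∃ F : C(Circ, R), ∀ t ∈ Set.Icc (0 : ℝ) 1, F (t : Circ) = f t := by
    intro f hf h01
    refine ⟨⟨AddCircle.liftIco 1 0 f, AddCircle.liftIco_zero_continuous h01 hf.continuousOn⟩, ?_⟩
    intro t ht
    rcases ht.2.eq_or_lt with rfl | h1
    · have : ((1 : ℝ) : Circ) = ((0 : ℝ) : Circ) := by simp
      rw [this, ← h01]
      exact AddCircle.liftIco_zero_coe_apply (by simp)
    · exact AddCircle.liftIco_zero_coe_apply ⟨ht.1, h1⟩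
  have hv : ∀ i, ∃ F : C(Circ, R), ∀ t ∈ Set.Icc (0 : ℝ) 1, F (t : Circ) = (γ.extend t).1 l i := by
    intro i
    refine lift _ (hγ1.matrix_elem l i) ?_
    rw [e0, e1]
    simp only [diagUnit, diagonal_apply, Units.val_one, Matrix.one_apply, hl0, if_false]
  have hw : ∀ i, ∃ F : C(Circ, R), ∀ t ∈ Set.Icc (0 : ℝ) 1,
      F (t : Circ) = (γ.extend t)⁻¹.1 i l := by
    intro i
    refine lift _ (hγ2.matrix_elem i l) ?_
    rw [e0, e1]
    have : (diagUnit (n + 1) u)⁻¹.1 = diagonal fun j => if j = 0 then u⁻¹.1 else 1 := rfl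
    rw [this]
    by_cases hi : i = l
    · subst hi
      simp [hl0]
    · simp [hi]
  choose v hv using hv
  choose w hw using hw
  have hcirc : ∀ x : Circ, ∃ t ∈ Set.Icc (0 : ℝ) 1, (t : Circ) = x := fun x => by
    obtain ⟨b, hb, rfl⟩ := AddCircle.eq_coe_Ico x
    exact ⟨b, ⟨hb.1, hb.2.le⟩, rfl⟩
  have hvw : UnimodularRow v := by
    refine ⟨w, ContinuousMap.ext fun x => ?_⟩
    obtain ⟨t, ht, rfl⟩ := hcirc x
    have := congrFun (congrFun (γ.extend t).mul_inv l) l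
    rw [Matrix.mul_apply] at this
    simp only [dotProduct, ContinuousMap.sum_apply, ContinuousMap.mul_apply, hv _ _ ht, hw _ _ ht]
    simpa using this
  obtain ⟨k, g, hg⟩ := hvw.rowEquiv_single_constHom hR l
  have hrow : ∀ t ∈ Set.Icc (0 : ℝ) 1,
      (γ.extend t).1 l ᵥ* (evalUnit g t).1 = Pi.single l k.1 := by
    intro t ht
    ext j
    have := congrArg (fun f : C(Circ, R) => f t) (congrFun hg j)
    simp only [vecMul, dotProduct, ContinuousMap.sum_apply, ContinuousMap.mul_apply,
      hv _ _ ht] at this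
    refine this.trans ?_
    by_cases hj : j = l
    · subst hj; simp; rfl
    · simp [hj]
  let N : ℝ → (Matrix (Fin (n + 2)) (Fin (n + 2)) R)ˣ := fun t =>
    γ.extend t * evalUnit g t * (evalUnit g 0)⁻¹
  have hN : Continuous N :=
    (hγ.mul ((continuous_evalUnit g).comp (AddCircle.continuous_mk' 1))).mul continuous_const
  have hNl : ∀ t ∈ Set.Icc (0 : ℝ) 1, (N t).1 l = Pi.single l 1 := by
    intro t ht
    have h0 := hrow 0 (by simp)
    have h0' : Pi.single l k.1 ᵥ* (evalUnit g 0)⁻¹.1 = Pi.single l 1 := by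
      rw [← h0, e0, ← one_row l, AddCircle.coe_zero, vecMul_vecMul, Units.mul_inv, vecMul_one]
      rfl
    have : (N t).1 l = ((γ.extend t).1 l ᵥ* (evalUnit g t).1) ᵥ* (evalUnit g 0)⁻¹.1 := by
      rw [← mul_apply_eq_vecMul, ← mul_apply_eq_vecMul]
      rfl
    rw [this, hrow t ht, h0']
  have hN0 : N 0 = 1 := by simp [N, e0]
  have hN1 : N 1 = diagUnit (n + 1) u := by
    have : ((1 : ℝ) : Circ) = 0 := by simp
    simp only [N, e1, this, mul_inv_cancel_right]
  refine ⟨⟨⟨fun t => cutUnit (N t) (hNl t t.2), ?_⟩, ?_, ?_⟩⟩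
  · obtain ⟨h1, h2⟩ := Units.continuous_iff.1 hN
    refine Units.continuous_iff.2 ⟨?_, ?_⟩ <;> refine continuous_matrix fun i j => ?_
    · exact (h1.matrix_elem i.castSucc j.castSucc).comp continuous_subtype_val
    · exact (h2.matrix_elem i.castSucc j.castSucc).comp continuous_subtype_val
  · ext i j
    simp [cutUnit, hN0, Matrix.one_apply]
  · ext i j
    simp [cutUnit, hN1, diagUnit, diagonal_apply]

lemma joined_of_joined_diagUnit (hR : ∀ (r : R) (η : ℝ), 0 < η → ∃ c : Rˣ, ‖c.1 - r‖ < η) (n : ℕ)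
    (u : Rˣ) (h : Joined 1 (diagUnit n u)) : Joined 1 u := by
  induction n with
  | succ n ih => exact ih (joined_diagUnit_of_succ hR n u h)
  | zero =>
    let φ : Matrix (Fin 1) (Fin 1) R →* R :=
      ⟨⟨fun M => M 0 0, rfl⟩, fun M M' => by simp [Matrix.mul_apply]⟩
    have hφ : Continuous φ := continuous_id.matrix_elem 0 0
    have := h.map (f := Units.map φ) (hφ.units_map φ)
    rw [map_one] at this
    convert this
    ext
    simp only [Units.coe_map, diagUnit]
    rfl

end Injectivity

section Polar

open Topology

variable {R : Type*} [CStarAlgebra R] [PartialOrder R] [StarOrderedRing R]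

lemma IsUnit.isStrictlyPositive_abs {w : R} (hw : IsUnit w) : IsStrictlyPositive (CFC.abs w) := by
  have h1 : IsUnit (CFC.abs w * CFC.abs w) := by
    rw [CFC.abs_mul_abs]
    exact hw.star.mul hw
  exact ((Commute.refl (CFC.abs w)).isUnit_mul_iff.1 h1).1.isStrictlyPositive (CFC.abs_nonneg w)

lemma IsUnit.exists_unitary_mul_abs {w : R} (hw : IsUnit w) :
    ∃ u : unitary R, w = u.1 * CFC.abs w := by
  obtain ⟨m, hm⟩ := hw.isStrictlyPositive_abs.isUnit
  have hs : star m.1 = m.1 := by rw [hm]; exact (CFC.abs_nonneg w).isSelfAdjoint.star_eq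
  have hs' : star (m⁻¹).1 = (m⁻¹).1 := by
    rw [← Units.coe_star_inv, Units.inv_unique]
    exact hs
  have hstar : star w * w = m.1 * m.1 := by rw [hm, CFC.abs_mul_abs]
  have h1 : star (w * (m⁻¹).1) * (w * (m⁻¹).1) = 1 := by
    rw [star_mul, hs', mul_assoc, ← mul_assoc (star w), hstar]
    simp [mul_assoc]
  refine ⟨⟨w * (m⁻¹).1, h1, ?_⟩, ?_⟩
  · obtain ⟨c, hc⟩ := hw.mul m⁻¹.isUnit
    rw [← hc] at h1 ⊢
    rw [Units.eq_inv_of_mul_eq_one_right h1, Units.mul_inv]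
  · simp [← hm, mul_assoc]

lemma convex_isStrictlyPositive : Convex ℝ {x : R | IsStrictlyPositive x} := by
  intro x hx y hy a b ha hb hab
  rcases ha.eq_or_lt with rfl | ha
  · have : b = 1 := by linarith
    subst this
    simpa using hy
  · exact (IsStrictlyPositive.smul ha hx).add_nonneg (smul_nonneg hb hy.nonneg)

lemma norm_sub_le_of_mem_segment_of_le {E : Type*} [NormedAddCommGroup E] [NormedSpace ℝ E] {x y z h : E}
    {r : ℝ} (hx : ‖x - h‖ ≤ r) (hy : ‖y - h‖ ≤ r) (hz : z ∈ segment ℝ x y) : ‖z - h‖ ≤ r := by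
  have := (convex_closedBall h r).segment_subset (by simpa [dist_eq_norm] using hx)
    (by simpa [dist_eq_norm] using hy) hz
  simpa [dist_eq_norm] using this

lemma norm_sqrt_sub_sqrt_le {a b : R} (ha : 0 ≤ a) (hb : 0 ≤ b) :
    ‖CFC.sqrt a - CFC.sqrt b‖ ≤ √‖a - b‖ := by
  have key : ∀ a b : R, 0 ≤ a → 0 ≤ b →
      CFC.sqrt a ≤ CFC.sqrt b + algebraMap ℝ R (√‖a - b‖) := by
    intro a b ha hb
    set r := √‖a - b‖
    have hr : 0 ≤ r := Real.sqrt_nonneg _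
    have hr' : 0 ≤ algebraMap ℝ R r := algebraMap_nonneg _ hr
    have hsb := CFC.sqrt_nonneg b
    have h1 : a ≤ (CFC.sqrt b + algebraMap ℝ R r) * (CFC.sqrt b + algebraMap ℝ R r) := by
      have h2 : a - b ≤ algebraMap ℝ R ‖a - b‖ :=
        (ha.isSelfAdjoint.sub hb.isSelfAdjoint).le_algebraMap_norm_self
      have h3 : algebraMap ℝ R ‖a - b‖ = algebraMap ℝ R r * algebraMap ℝ R r := by
        rw [← map_mul, Real.mul_self_sqrt (norm_nonneg _)]
      have h4 : 0 ≤ (2 * r) • CFC.sqrt b := smul_nonneg (by positivity) hsb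
      have h5 : (CFC.sqrt b + algebraMap ℝ R r) * (CFC.sqrt b + algebraMap ℝ R r) =
          b + algebraMap ℝ R r * algebraMap ℝ R r + (2 * r) • CFC.sqrt b := by
        rw [add_mul, mul_add, mul_add, CFC.sqrt_mul_sqrt_self b, Algebra.commutes r (CFC.sqrt b),
          ← Algebra.commutes r (CFC.sqrt b), ← Algebra.smul_def, two_mul, add_smul]
        abel
      rw [h5, ← h3]
      calc a = b + (a - b) := by abel
        _ ≤ b + algebraMap ℝ R ‖a - b‖ := by gcongr
        _ ≤ _ := le_add_of_nonneg_right h4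
    have := CFC.sqrt_le_sqrt _ _ h1
    rwa [CFC.sqrt_mul_self (CFC.sqrt b + algebraMap ℝ R r) (add_nonneg hsb hr')] at this
  have hsa : IsSelfAdjoint (CFC.sqrt a - CFC.sqrt b) :=
    (CFC.sqrt_nonneg a).isSelfAdjoint.sub (CFC.sqrt_nonneg b).isSelfAdjoint
  rcases subsingleton_or_nontrivial R with _ | _
  · rw [Subsingleton.elim (CFC.sqrt a - CFC.sqrt b) 0]
    simp
  have h1 := (le_algebraMap_iff_spectrum_le hsa).1 (sub_le_iff_le_add'.2 (key a b ha hb))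
  have h2 : algebraMap ℝ R (-√‖a - b‖) ≤ CFC.sqrt a - CFC.sqrt b := by
    have := key b a hb ha
    rw [norm_sub_rev] at this
    rw [map_neg, neg_le_sub_iff_le_add]
    exact this
  have h2 := (algebraMap_le_iff_le_spectrum hsa).1 h2
  rcases CStarAlgebra.norm_or_neg_norm_mem_spectrum hsa with h | h
  · exact h1 _ h
  · linarith [h2 _ h]

lemma norm_abs_sub_le (g : R) {h : R} (hh : 0 ≤ h) :
    ‖CFC.abs g - h‖ ≤ √‖star g * g - h * h‖ := by
  have h1 : CFC.sqrt (h * h) = h := CFC.sqrt_mul_self h hh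
  have := norm_sqrt_sub_sqrt_le (star_mul_self_nonneg g)
    (by simpa [hh.isSelfAdjoint.star_eq] using star_mul_self_nonneg h : 0 ≤ h * h)
  rwa [h1] at this

end Polar

section StableRank

open Topology Unitization

lemma Unitization.eq_smul_one_add_inr {A : Type*} [NonUnitalRing A] [Module ℂ A]
    [IsScalarTower ℂ A A] [SMulCommClass ℂ A A] {x : Unitization ℂ A} (hx : x.fst ≠ 0) :
    x = x.fst • (1 + ((x.fst⁻¹ • x.snd : A) : Unitization ℂ A)) := by
  ext
  · simp
  · simp [smul_smul, hx]

lemma stableRankOne_iff {A : Type*} [NonUnitalCStarAlgebra A] :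
    StableRankOne A ↔ ∀ (a : A) (ε : ℝ), 0 < ε →
      ∃ a' : A, ‖a' - a‖ < ε ∧ IsUnit (1 + (a' : Unitization ℂ A)) := by
  have hunit : ∀ x : Unitization ℂ A, x.fst ≠ 0 →
      (IsUnit x ↔ IsUnit (1 + ((x.fst⁻¹ • x.snd : A) : Unitization ℂ A))) := by
    intro x hx
    conv_lhs => rw [eq_smul_one_add_inr hx]
    exact isUnit_smul_iff (Units.mk0 _ hx) _
  constructor
  · intro h a ε hε
    have hc : ContinuousAt (fun x : Unitization ℂ A => x.fst⁻¹ • x.snd)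
        (1 + (a : Unitization ℂ A)) := by
      refine ContinuousAt.smul (ContinuousAt.inv₀ Unitization.continuous_fst.continuousAt (by simp))
        Unitization.continuous_snd.continuousAt
    have h1 : ∀ᶠ x : Unitization ℂ A in 𝓝 (1 + (a : Unitization ℂ A)),
        ‖x.fst⁻¹ • x.snd - a‖ < ε ∧ x.fst ≠ 0 := by
      refine Filter.Eventually.and ?_ ?_
      · have := Metric.tendsto_nhds.1 hc.tendsto ε hε
        simpa [dist_eq_norm] using this
      · exact Unitization.continuous_fst.continuousAt.eventually_ne (by simp)
    obtain ⟨x, hx, hxu⟩ := h.inter_nhds_nonempty h1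
    exact ⟨_, hxu.1, (hunit x hxu.2).1 hx⟩
  · intro h
    refine Metric.dense_iff.2 fun x ε hε => ?_
    obtain ⟨c, hc0, hc⟩ : ∃ c : ℂ, c ≠ 0 ∧ ‖c - x.fst‖ < ε / 2 := by
      obtain ⟨c, hc, h0⟩ := (Metric.dense_iff.1 (dense_compl_singleton (0 : ℂ))) x.fst (ε / 2)
        (half_pos hε)
      exact ⟨c, h0, by simpa [dist_eq_norm] using hc⟩
    have hcn : 0 < ‖c‖ := norm_pos_iff.2 hc0
    obtain ⟨a, ha, hu⟩ := h (c⁻¹ • x.snd) (ε / 2 / ‖c‖) (by positivity)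
    refine ⟨c • (1 + (a : Unitization ℂ A)), ?_, (isUnit_smul_iff (Units.mk0 _ hc0) _).2 hu⟩
    rw [Metric.mem_ball, dist_eq_norm]
    have : c • (1 + (a : Unitization ℂ A)) - x =
        algebraMap ℂ (Unitization ℂ A) (c - x.fst) +
          ((c • (a - c⁻¹ • x.snd) : A) : Unitization ℂ A) := by
      ext
      · simp [algebraMap_eq_inl, sub_eq_add_neg]
      · simp [smul_smul, hc0, algebraMap_eq_inl, sub_eq_add_neg]
    rw [this]
    refine (norm_add_le _ _).trans_lt ?_
    rw [norm_inr, norm_smul, norm_algebraMap', ← add_halves ε]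
    refine add_lt_add hc ?_
    rwa [lt_div_iff₀' hcn] at ha

end StableRank

section Hereditary

open Topology Unitization

variable {A : Type*} [NonUnitalCStarAlgebra A] (B : NonUnitalStarSubalgebra ℂ A)

lemma isUnit_one_add_inr_iff_exists {A : Type*} [NonUnitalRing A] [Module ℂ A]
    [IsScalarTower ℂ A A] [SMulCommClass ℂ A A] (a : A) :
    IsUnit (1 + (a : Unitization ℂ A)) ↔ ∃ b : A, a + b + a * b = 0 ∧ a + b + b * a = 0 := by
  constructor
  · rintro ⟨u, hu⟩
    have h1 := u.mul_inv
    have h2 := u.inv_mul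
    rw [hu] at h1 h2
    have hf : (u⁻¹).1.fst = 1 := by simpa using congrArg (fun x => x.fst) h1
    have hx : (u⁻¹).1 = 1 + ((u⁻¹).1.snd : Unitization ℂ A) := by
      ext <;> simp [hf]
    rw [hx] at h1 h2
    refine ⟨(u⁻¹).1.snd, ?_, ?_⟩
    · have := congrArg (fun x => x.snd) h1
      simp at this
      rw [← this]; abel
    · have := congrArg (fun x => x.snd) h2
      simp at this
      rw [← this]
  · rintro ⟨b, h1, h2⟩
    refine ⟨⟨1 + a, 1 + b, ?_, ?_⟩, rfl⟩
    · ext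
      · simp
      · simp
        rw [← h1]; abel
    · ext
      · simp
      · simp
        rw [← h2]

variable {B}

lemma isUnit_one_add_inr_of_hereditary
    (hB : ∀ b ∈ B, ∀ a : A, ∀ b' ∈ B, b * a * b' ∈ B) (b : B)
    (h : IsUnit (1 + ((b : A) : Unitization ℂ A))) : IsUnit (1 + (b : Unitization ℂ B)) := by
  rw [isUnit_one_add_inr_iff_exists] at h ⊢
  obtain ⟨c, h1, h2⟩ := h
  have hc : c = -b.1 + b.1 * b.1 + b.1 * c * b.1 := by
    have h3 : c = -b.1 - b.1 * c := by rw [← sub_eq_zero, ← h1]; abel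
    have h4 : b.1 * c = - (b.1 * b.1) - b.1 * c * b.1 := by
      have : b.1 * (b.1 + c + c * b.1) = 0 := by rw [h2, mul_zero]
      rw [mul_add, mul_add, ← mul_assoc] at this
      rw [← sub_eq_zero, ← this]; abel
    rw [h4] at h3
    rw [← sub_eq_zero, ← sub_eq_zero.2 h3]; abel
  have hcB : c ∈ B := by
    rw [hc]
    exact add_mem (add_mem (neg_mem b.2) (mul_mem b.2 b.2)) (hB _ b.2 _ _ b.2)
  exact ⟨⟨c, hcB⟩, Subtype.ext h1, Subtype.ext h2⟩

end Hereditary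

section HereditaryStableRank

open Topology Unitization

lemma IsUnit.one_add_mul_swap {R : Type*} [Ring R] {x y : R} (h : IsUnit (1 + x * y)) :
    IsUnit (1 + y * x) := by
  obtain ⟨c, hc⟩ := h
  have h1 : c⁻¹.1 + x * y * c⁻¹.1 = 1 := by
    have := c.mul_inv
    rwa [hc, add_mul, one_mul] at this
  have h2 : c⁻¹.1 + c⁻¹.1 * (x * y) = 1 := by
    have := c.inv_mul
    rwa [hc, mul_add, mul_one] at this
  refine ⟨⟨1 + y * x, 1 - y * c⁻¹.1 * x, ?_, ?_⟩, rfl⟩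
  · have : (1 + y * x) * (1 - y * c⁻¹.1 * x) =
        1 + y * x - y * (c⁻¹.1 + x * y * c⁻¹.1) * x := by noncomm_ring
    rw [this, h1]; noncomm_ring
  · have : (1 - y * c⁻¹.1 * x) * (1 + y * x) =
        1 + y * x - y * (c⁻¹.1 + c⁻¹.1 * (x * y)) * x := by noncomm_ring
    rw [this, h2]; noncomm_ring

lemma exists_approximate_unit {B : Type*} [NonUnitalCStarAlgebra B] (b : B) {η : ℝ} (hη : 0 < η) :
    ∃ e : B, ‖e‖ ≤ 1 ∧ ‖e * b - b‖ < η ∧ ‖b * e - b‖ < η := by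
  let := CStarAlgebra.spectralOrder B
  let := CStarAlgebra.spectralOrderedRing B
  have h := CStarAlgebra.increasingApproximateUnit B
  have h1 := Metric.tendsto_nhds.1 (h.tendsto_mul_left b) η hη
  have h2 := Metric.tendsto_nhds.1 (h.tendsto_mul_right b) η hη
  obtain ⟨e, he, he1, he2⟩ := (h.eventually_norm.and (h1.and h2)).exists
  exact ⟨e, he, by simpa [dist_eq_norm] using he2, by simpa [dist_eq_norm] using he1⟩

variable {A : Type*} [NonUnitalCStarAlgebra A] {B : NonUnitalStarSubalgebra ℂ A}

lemma StableRankOne.of_hereditary [IsClosed (B : Set A)] (hA : StableRankOne A)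
    (hB : ∀ b ∈ B, ∀ a : A, ∀ b' ∈ B, b * a * b' ∈ B) : StableRankOne B := by
  rw [stableRankOne_iff] at hA ⊢
  intro b ε hε
  obtain ⟨ρ, hρ, hinv⟩ := Metric.continuousAt_iff.1
    (NormedRing.inverse_continuousAt (1 : (Unitization ℂ A)ˣ)) (ε / (2 * (‖b‖ + 1))) (by positivity)
  set η := min (min (1 / 8) (ρ / 8)) (ε / 8) with hηdef
  have hη : 0 < η := by positivity
  have hη1 : η ≤ 1 / 8 := (min_le_left _ _).trans (min_le_left _ _)
  have hη2 : η ≤ ρ / 8 := (min_le_left _ _).trans (min_le_right _ _)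
  have hη3 : η ≤ ε / 8 := min_le_right _ _
  obtain ⟨e, he, heb, hbe⟩ := exists_approximate_unit b hη
  obtain ⟨T, hT, hTu⟩ := hA b η hη
  let E : Unitization ℂ A := ((e : A) : Unitization ℂ A)
  let b' : Unitization ℂ A := ((b : A) : Unitization ℂ A)
  let T' : Unitization ℂ A := (T : Unitization ℂ A)
  have hE : ‖E‖ ≤ 1 := by simpa [E, norm_inr] using he
  have hEb : ‖E * b' - b'‖ < η := by
    have : E * b' - b' = ((e * b - b : B) : A) := by simp [E, b']
    rw [this, norm_inr]; exact heb
  have hbE : ‖b' * E - b'‖ < η := by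
    have : b' * E - b' = ((b * e - b : B) : A) := by simp [E, b']
    rw [this, norm_inr]; exact hbe
  have hTb : ‖T' - b'‖ < η := by
    have : T' - b' = ((T - b : A) : Unitization ℂ A) := by simp [T', b']
    rw [this, norm_inr]; exact hT
  have hT' : ‖T'‖ ≤ ‖b‖ + 1 := by
    have : ‖b'‖ = ‖b‖ := norm_inr _
    have h2 : ‖T'‖ ≤ ‖b'‖ + ‖T' - b'‖ := by
      simpa using norm_add_le b' (T' - b')
    linarith
  set N := (1 - E * E) * T' with hN
  have hNn : ‖N‖ ≤ 4 * η := by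
    have h1 : N = -(E * (E * b' - b')) - (E * b' - b') + (T' - b') - E * (E * (T' - b')) := by
      rw [hN]; noncomm_ring
    have h2 : ‖E * (E * b' - b')‖ ≤ η := by
      refine (norm_mul_le _ _).trans ?_
      nlinarith [norm_nonneg E, norm_nonneg (E * b' - b')]
    have h3 : ‖E * (E * (T' - b'))‖ ≤ η := by
      refine (norm_mul_le _ _).trans ?_
      have := norm_mul_le E (T' - b')
      have h4 : ‖E‖ * ‖T' - b'‖ ≤ 1 * ‖T' - b'‖ := by gcongr
      nlinarith [norm_nonneg E, norm_nonneg (E * (T' - b'))]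
    rw [h1]
    calc _ ≤ ‖-(E * (E * b' - b'))‖ + ‖E * b' - b'‖ + ‖T' - b'‖ + ‖E * (E * (T' - b'))‖ := by
          refine (norm_sub_le _ _).trans (add_le_add_left ((norm_add_le _ _).trans
            (add_le_add_left (norm_sub_le _ _) _)) _)
      _ ≤ _ := by rw [norm_neg]; linarith
  have hMu : IsUnit (1 + N) := by
    have := isUnit_one_sub_of_norm_lt_one (x := -N) (by rw [norm_neg]; linarith)
    rwa [sub_neg_eq_add] at this
  have hMinv : ‖Ring.inverse (1 + N) - 1‖ < ε / (2 * (‖b‖ + 1)) := by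
    have := hinv (x := 1 + N) (by
      rw [dist_eq_norm, Units.val_one, add_sub_cancel_left]; linarith)
    rwa [Units.val_one, Ring.inverse_one, dist_eq_norm] at this
  obtain ⟨M, hM⟩ := hMu
  rw [← hM, Ring.inverse_unit] at hMinv
  have hW0 : (T' * M⁻¹.1).fst = 0 := by simp [T']
  set W : A := (T' * M⁻¹.1).snd with hWdef
  have hW : T' * M⁻¹.1 = W := by
    ext
    · simp [hW0]
    · simp [hWdef]
  have h1 : 1 + E * (E * W) = (1 + T') * M⁻¹.1 := by
    have : 1 + T' = M.1 + E * E * T' := by rw [hM, hN]; noncomm_ring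
    rw [this, add_mul, M.mul_inv, ← hW]
    noncomm_ring
  have h2 : IsUnit (1 + E * W * E) := by
    refine IsUnit.one_add_mul_swap ?_
    rw [h1]
    exact hTu.mul M⁻¹.isUnit
  refine ⟨⟨e * W * e, hB _ e.2 _ _ e.2⟩, ?_, isUnit_one_add_inr_of_hereditary hB _ ?_⟩
  · have h3 : ‖(⟨e * W * e, hB _ e.2 _ _ e.2⟩ : B) - b‖ = ‖E * W * E - b'‖ := by
      have : E * W * E - b' = ((e * W * e - b : A) : Unitization ℂ A) := by simp [E, b']
      rw [this, norm_inr]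
      rfl
    rw [h3]
    have h4 : E * W * E - b' = E * (T' * (M⁻¹.1 - 1)) * E + E * (T' - b') * E +
        E * (b' * E - b') + (E * b' - b') := by
      rw [← hW]; noncomm_ring
    have hEE : ∀ x : Unitization ℂ A, ‖E * x‖ ≤ ‖x‖ := fun x =>
      (norm_mul_le _ _).trans (mul_le_of_le_one_left (norm_nonneg _) hE)
    have hEE' : ∀ x : Unitization ℂ A, ‖x * E‖ ≤ ‖x‖ := fun x =>
      (norm_mul_le _ _).trans (mul_le_of_le_one_right (norm_nonneg _) hE)
    have h5 : ‖T' * (M⁻¹.1 - 1)‖ ≤ ε / 2 := by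
      refine (norm_mul_le _ _).trans ?_
      calc ‖T'‖ * ‖M⁻¹.1 - 1‖ ≤ (‖b‖ + 1) * (ε / (2 * (‖b‖ + 1))) := by gcongr
        _ = ε / 2 := by field_simp
    rw [h4]
    calc _ ≤ ‖E * (T' * (M⁻¹.1 - 1)) * E‖ + ‖E * (T' - b') * E‖ + ‖E * (b' * E - b')‖ +
          ‖E * b' - b'‖ := norm_add₄_le
      _ ≤ ‖T' * (M⁻¹.1 - 1)‖ + ‖T' - b'‖ + ‖b' * E - b'‖ + ‖E * b' - b'‖ := by
          gcongr
          · exact (hEE' _).trans (hEE _)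
          · exact (hEE' _).trans (hEE _)
          · exact hEE _
      _ < ε := by linarith
  · simpa [E] using h2

end HereditaryStableRank

section UnitizationUnits

open Unitization

variable {A : Type*} [NonUnitalCStarAlgebra A]

lemma Unitization.fst_ne_zero_of_isUnit {x : Unitization ℂ A} (hx : IsUnit x) : x.fst ≠ 0 := by
  obtain ⟨x, rfl⟩ := hx
  intro h0
  have := congrArg (fun x => x.fst) x.mul_inv
  simp only [Unitization.fst_mul, h0, zero_mul, Unitization.fst_one] at this
  exact zero_ne_one this

lemma Unitization.isUnit_one_add_inr_snd {x : Unitization ℂ A} (hx : IsUnit x) :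
    IsUnit (1 + ((x.fst⁻¹ • x.snd : A) : Unitization ℂ A)) := by
  have h0 := fst_ne_zero_of_isUnit hx
  rw [eq_smul_one_add_inr h0] at hx
  exact (isUnit_smul_iff (Units.mk0 _ h0) _).1 hx

end UnitizationUnits

section K1

open Topology Unitization Matrix

lemma Joined.joinedIn_isUnit {R : Type*} [Monoid R] [TopologicalSpace R] {u v : Rˣ}
    (h : Joined u v) : JoinedIn {x : R | IsUnit x} u.1 v.1 := by
  obtain ⟨γ⟩ := h
  exact ⟨γ.map Units.continuous_val, fun t => (γ t).isUnit⟩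

lemma JoinedIn.mul_right_of_isUnit {R : Type*} [Monoid R] [TopologicalSpace R] [ContinuousMul R]
    {x y c : R} (h : JoinedIn {x : R | IsUnit x} x y) (hc : IsUnit c) :
    JoinedIn {x : R | IsUnit x} (x * c) (y * c) := by
  refine (h.map (f := fun z => z * c) (by fun_prop)).mono ?_
  rintro _ ⟨z, hz, rfl⟩
  exact IsUnit.mul hz hc

variable {B : Type*} [NonUnitalCStarAlgebra B]

lemma StableRankOne.exists_units_norm_sub_lt (hs : StableRankOne B) (r : Unitization ℂ B) (η : ℝ)
    (hη : 0 < η) : ∃ c : (Unitization ℂ B)ˣ, ‖c.1 - r‖ < η := by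
  obtain ⟨x, hx, ⟨c, rfl⟩⟩ := Metric.dense_iff.1 hs r η hη
  exact ⟨c, by simpa [dist_eq_norm] using hx⟩

lemma K1Trivial.joined_one_toUnits (hk : K1Trivial B) (hs : StableRankOne B)
    (u : unitary (Unitization ℂ B)) : Joined 1 (Unitary.toUnits u) := by
  have hU : diagonal (fun _ : Fin 1 => u.1) ∈ unitary (Matrix (Fin 1) (Fin 1) (Unitization ℂ B)) := by
    rw [Unitary.mem_iff, star_eq_conjTranspose, diagonal_conjTranspose, diagonal_mul_diagonal,
      diagonal_mul_diagonal, ← diagonal_one]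
    simp
  obtain ⟨k, h, hj⟩ := hk 1 one_pos ⟨_, hU⟩
  let e : Fin 1 ⊕ Fin k ≃ Fin (k + 1) := finSumFinEquiv.trans (finCongr (add_comm 1 k))
  have he : e (Sum.inl 0) = 0 := by
    ext; simp [e]
  let φ : unitary (Matrix (Fin 1 ⊕ Fin k) (Fin 1 ⊕ Fin k) (Unitization ℂ B)) →*
      (Matrix (Fin (k + 1)) (Fin (k + 1)) (Unitization ℂ B))ˣ :=
    (Units.map (reindexRingEquiv (Unitization ℂ B) e).toRingHom.toMonoidHom).comp Unitary.toUnits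
  have hφ : Continuous φ := by
    refine Units.continuous_iff.2 ⟨?_, ?_⟩ <;> refine continuous_matrix fun i j => ?_
    · exact (continuous_subtype_val (p := (· ∈ unitary (Matrix (Fin 1 ⊕ Fin k) (Fin 1 ⊕ Fin k)
        (Unitization ℂ B))))).matrix_elem (e.symm i) (e.symm j)
    · exact (continuous_star.comp continuous_subtype_val).matrix_elem (e.symm i) (e.symm j)
  refine joined_of_joined_diagUnit hs.exists_units_norm_sub_lt k (Unitary.toUnits u) ?_
  have := hj.map hφ
  rw [map_one] at this
  convert this
  ext1
  have h1 : (φ ⟨fromBlocks (diagonal (fun _ : Fin 1 => u.1)) 0 0 1, h⟩).1 =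
      reindex e e (fromBlocks (diagonal (fun _ : Fin 1 => u.1)) 0 0 1) := rfl
  rw [h1]
  symm
  rw [← Equiv.eq_symm_apply]
  ext1 i j
  simp only [diagUnit, reindex_symm, reindex_apply, submatrix_apply, Equiv.symm_symm]
  have he' : ∀ i, e (Sum.inr i) ≠ 0 := fun i h0 => by
    rw [← he, e.apply_eq_iff_eq] at h0; cases h0
  rcases i with i | i <;> rcases j with j | j
  · obtain rfl := Subsingleton.elim i 0
    obtain rfl := Subsingleton.elim j 0
    simp [he]
  · simp
  · simp
  · simp [diagonal_apply, Matrix.one_apply, he']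

lemma K1Trivial.joinedIn_one (hk : K1Trivial B) (hs : StableRankOne B) {x : Unitization ℂ B}
    (hx : IsUnit x) : JoinedIn {x : Unitization ℂ B | IsUnit x} x 1 := by
  let := CStarAlgebra.spectralOrder (Unitization ℂ B)
  let := CStarAlgebra.spectralOrderedRing (Unitization ℂ B)
  obtain ⟨u, hu⟩ := hx.exists_unitary_mul_abs
  have h1 := (hk.joined_one_toUnits hs u).joinedIn_isUnit.mul_right_of_isUnit
    hx.isStrictlyPositive_abs.isUnit
  rw [Units.val_one, one_mul, Unitary.val_toUnits_apply, ← hu] at h1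
  have h2 : JoinedIn {x : Unitization ℂ B | IsUnit x} (CFC.abs x) 1 :=
    (JoinedIn.of_segment_subset (convex_isStrictlyPositive.segment_subset
      hx.isStrictlyPositive_abs isStrictlyPositive_one)).mono fun y hy => hy.isUnit
  exact h1.symm.trans h2

end K1

section HereditaryPath

open Topology Unitization

variable {A : Type*} [NonUnitalCStarAlgebra A] {B : NonUnitalStarSubalgebra ℂ A}

lemma NoK1Obstructions.joinedIn_one [IsClosed (B : Set A)] (hA : NoK1Obstructions A)
    (hB : ∀ b ∈ B, ∀ a : A, ∀ b' ∈ B, b * a * b' ∈ B) {b : A} (hb : b ∈ B)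
    (hu : IsUnit (1 + (b : Unitization ℂ A))) :
    JoinedIn {x : Unitization ℂ A | IsUnit x ∧ ∃ c ∈ B, x = 1 + (c : Unitization ℂ A)}
      (1 + (b : Unitization ℂ A)) 1 := by
  have h := (hA.2 B hB).joinedIn_one (hA.1.of_hereditary hB)
    (isUnit_one_add_inr_of_hereditary hB ⟨b, hb⟩ hu)
  let F : Unitization ℂ B → Unitization ℂ A :=
    fun x => 1 + ((x.fst⁻¹ • (x.snd : A) : A) : Unitization ℂ A)
  have hF : ContinuousOn F {x | IsUnit x} := by
    refine continuousOn_const.add (Unitization.continuous_inr.comp_continuousOn ?_)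
    exact (Unitization.continuous_fst.continuousOn.inv₀ fun _ => fst_ne_zero_of_isUnit).smul
      (continuous_subtype_val.comp Unitization.continuous_snd).continuousOn
  have := h.map_continuousOn hF
  have e1 : F (1 + ((⟨b, hb⟩ : B) : Unitization ℂ B)) = 1 + (b : Unitization ℂ A) := by simp [F]
  have e2 : F 1 = 1 := by simp [F]
  rw [e1, e2] at this
  refine this.mono ?_
  rintro _ ⟨x, hx, rfl⟩
  refine ⟨?_, _, SMulMemClass.smul_mem _ x.snd.2, rfl⟩
  have hx' : IsUnit (1 + ((x.fst⁻¹ • x.snd : B) : Unitization ℂ B)) :=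
    isUnit_one_add_inr_snd hx
  rw [isUnit_one_add_inr_iff_exists] at hx' ⊢
  obtain ⟨c, h1, h2⟩ := hx'
  exact ⟨c, congrArg Subtype.val h1, congrArg Subtype.val h2⟩

end HereditaryPath

section Cutdown

variable {R : Type*} [CStarAlgebra R]

lemma norm_mul_unitary_sub (u : unitary R) {h : R} (hh : IsSelfAdjoint h) :
    ‖h * (u.1 - 1)‖ = ‖(u.1 - 1) * h‖ := by
  have h1 : star (h * (u.1 - 1)) = -(star u.1 * ((u.1 - 1) * h)) := by
    have := Unitary.star_mul_self_of_mem u.2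
    rw [star_mul, hh.star_eq, ← mul_assoc, mul_sub, this]
    simp only [star_sub, star_one, mul_one, ← neg_mul, neg_sub]
  rw [← norm_star, h1, norm_neg]
  exact CStarRing.norm_coe_unitary_mul (star u) _

lemma isUnit_of_norm_sub_unitary_lt_one (u : unitary R) {v : R} (hv : ‖v - u.1‖ < 1) :
    IsUnit v := by
  have h1 : IsUnit (star u.1 * v) := by
    have h2 : star u.1 * v = 1 - star u.1 * (u.1 - v) := by
      rw [mul_sub, Unitary.star_mul_self_of_mem u.2]
      abel
    rw [h2]
    refine isUnit_one_sub_of_norm_lt_one ?_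
    have h3 : ‖star u.1 * (u.1 - v)‖ = ‖u.1 - v‖ := CStarRing.norm_coe_unitary_mul (star u) _
    rwa [h3, norm_sub_rev]
  have h2 : v = u.1 * (star u.1 * v) := by
    rw [← mul_assoc, Unitary.mul_star_self_of_mem u.2, one_mul]
  rw [h2]
  exact (Unitary.toUnits u).isUnit.mul h1

variable [PartialOrder R] [StarOrderedRing R]

lemma exists_spectral_cutoff {h : R} (hh : 0 ≤ h) {e : ℝ} (he : 0 < e) :
    ∃ p q k : R, p = 1 - h * q ∧ p = 1 - q * h ∧ ‖p‖ ≤ 1 ∧ ‖q‖ ≤ e⁻¹ ∧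
      0 ≤ k ∧ ‖h - k‖ ≤ e ∧ p * k = 0 ∧ k * p = 0 := by
  have hspec : ∀ t ∈ spectrum ℝ h, 0 ≤ t := fun t ht => spectrum_nonneg_of_nonneg hh ht
  have hm : ∀ t : ℝ, 0 < max t e := fun t => lt_max_of_lt_right he
  have hqc : Continuous fun t : ℝ => (max t e)⁻¹ :=
    (continuous_id.max continuous_const).inv₀ fun t => (hm t).ne'
  have htq : Continuous fun t : ℝ => t * (max t e)⁻¹ := continuous_id.mul hqc
  have hpc : Continuous fun t : ℝ => 1 - t * (max t e)⁻¹ :=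
    continuous_const.sub htq
  have hkc : Continuous fun t : ℝ => max (t - e) 0 := by fun_prop
  have hpk : ∀ t : ℝ, (1 - t * (max t e)⁻¹) * max (t - e) 0 = 0 := by
    intro t
    rcases le_total t e with h1 | h1
    · simp [h1]
    · rw [max_eq_left h1, mul_inv_cancel₀ (he.trans_le h1).ne']
      simp
  have hsa : IsSelfAdjoint h := hh.isSelfAdjoint
  have hid : cfc (fun t : ℝ => t) h = h := cfc_id' ℝ h
  refine ⟨cfc (fun t : ℝ => 1 - t * (max t e)⁻¹) h, cfc (fun t : ℝ => (max t e)⁻¹) h,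
    cfc (fun t : ℝ => max (t - e) 0) h, ?_, ?_, ?_, ?_, ?_, ?_, ?_, ?_⟩
  · rw [cfc_sub _ _ h (by fun_prop) htq.continuousOn, cfc_const_one ℝ h,
      cfc_mul _ _ h (by fun_prop) hqc.continuousOn, hid]
  · simp_rw [fun t : ℝ => mul_comm t (max t e)⁻¹] at htq ⊢
    rw [cfc_sub _ _ h (by fun_prop) htq.continuousOn, cfc_const_one ℝ h,
      cfc_mul _ _ h hqc.continuousOn (by fun_prop), hid]
  · refine norm_cfc_le zero_le_one fun t ht => ?_
    have h0 := hspec t ht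
    have h1 : t * (max t e)⁻¹ ≤ 1 := by
      rw [← div_eq_mul_inv]
      exact div_le_one_of_le₀ (le_max_left _ _) (hm t).le
    have h2 : 0 ≤ t * (max t e)⁻¹ := mul_nonneg h0 (inv_nonneg.2 (hm t).le)
    rw [Real.norm_eq_abs, abs_le]
    constructor <;> linarith
  · refine norm_cfc_le (inv_nonneg.2 he.le) fun t ht => ?_
    rw [Real.norm_eq_abs, abs_of_pos (inv_pos.2 (hm t))]
    exact inv_anti₀ he (le_max_right _ _)
  · exact cfc_nonneg fun t _ => le_max_right _ _
  · have : h - cfc (fun t : ℝ => max (t - e) 0) h = cfc (fun t : ℝ => t - max (t - e) 0) h := by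
      rw [cfc_sub _ _ h (by fun_prop) hkc.continuousOn, hid]
    rw [this]
    refine norm_cfc_le he.le fun t ht => ?_
    have h0 := hspec t ht
    rw [Real.norm_eq_abs, abs_le]
    rcases le_total t e with h1 | h1
    · rw [max_eq_right (by linarith)]
      constructor <;> linarith
    · rw [max_eq_left (by linarith)]
      constructor <;> linarith
  · rw [← cfc_mul _ _ h hpc.continuousOn hkc.continuousOn]
    simp_rw [hpk]
    exact cfc_const_zero ℝ h
  · rw [← cfc_mul _ _ h hkc.continuousOn hpc.continuousOn]
    simp_rw [mul_comm (max _ _) _, hpk]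
    exact cfc_const_zero ℝ h

end Cutdown

section AnnihilatorPath

open Topology Unitization

variable {A : Type*} [NonUnitalCStarAlgebra A]

/-- The elements of `A` annihilated by a self-adjoint element of the unitization on both sides. -/
def selfAdjointAnnihilator (k : Unitization ℂ A) (hk : IsSelfAdjoint k) :
    NonUnitalStarSubalgebra ℂ A where
  carrier := {x | (x : Unitization ℂ A) * k = 0 ∧ k * (x : Unitization ℂ A) = 0}
  add_mem' := by
    rintro a b ⟨h1, h2⟩ ⟨h3, h4⟩
    constructor
    · rw [inr_add, add_mul, h1, h3, add_zero]
    · rw [inr_add, mul_add, h2, h4, add_zero]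
  zero_mem' := by simp
  mul_mem' := by
    rintro a b ⟨h1, h2⟩ ⟨h3, h4⟩
    constructor
    · rw [inr_mul, mul_assoc, h3, mul_zero]
    · rw [inr_mul, ← mul_assoc, h2, zero_mul]
  smul_mem' := by
    rintro c a ⟨h1, h2⟩
    constructor
    · rw [inr_smul, smul_mul_assoc, h1, smul_zero]
    · rw [inr_smul, mul_smul_comm, h2, smul_zero]
  star_mem' := by
    rintro a ⟨h1, h2⟩
    constructor
    · rw [inr_star, ← star_inj, star_mul, star_star, hk.star_eq, h2, star_zero]
    · rw [inr_star, ← star_inj, star_mul, star_star, hk.star_eq, h1, star_zero]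

lemma mem_selfAdjointAnnihilator {k : Unitization ℂ A} {hk : IsSelfAdjoint k} {x : A} :
    x ∈ selfAdjointAnnihilator k hk ↔
      (x : Unitization ℂ A) * k = 0 ∧ k * (x : Unitization ℂ A) = 0 := Iff.rfl

lemma isClosed_selfAdjointAnnihilator (k : Unitization ℂ A) (hk : IsSelfAdjoint k) :
    IsClosed (selfAdjointAnnihilator k hk : Set A) :=
  (isClosed_singleton.preimage (f := fun x : A => (x : Unitization ℂ A) * k)
    (Unitization.continuous_inr.mul continuous_const)).inter
  (isClosed_singleton.preimage (f := fun x : A => k * (x : Unitization ℂ A))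
    (continuous_const.mul Unitization.continuous_inr))

lemma hereditary_selfAdjointAnnihilator (k : Unitization ℂ A) (hk : IsSelfAdjoint k) :
    ∀ b ∈ selfAdjointAnnihilator k hk, ∀ a : A, ∀ b' ∈ selfAdjointAnnihilator k hk,
      b * a * b' ∈ selfAdjointAnnihilator k hk := by
  intro b hb a b' hb'
  rw [mem_selfAdjointAnnihilator] at *
  constructor
  · rw [inr_mul, mul_assoc, hb'.1, mul_zero]
  · rw [inr_mul, inr_mul, mul_assoc, ← mul_assoc k, hb.2, zero_mul]

variable [PartialOrder (Unitization ℂ A)] [StarOrderedRing (Unitization ℂ A)]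

lemma NoK1Obstructions.exists_joinedIn_unitary_mul (hA : NoK1Obstructions A)
    {u : unitary (Unitization ℂ A)} (hu : u.1.fst = 1) {h : Unitization ℂ A} (hh : 0 ≤ h) {e : ℝ}
    (he : 0 < e) (huh : ‖(u.1 - 1) * h‖ ≤ e / 4) :
    ∃ m : Unitization ℂ A, IsStrictlyPositive m ∧ ‖m - h‖ ≤ 2 * e ∧
      JoinedIn {x : Unitization ℂ A | IsUnit x ∧ ‖x - h‖ ≤ 6 * e} (u.1 * m) m := by
  obtain ⟨p, q, k, hp, hp', hp1, hq, hk, hhk, hpk, hkp⟩ := exists_spectral_cutoff hh he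
  have hks := hk.isSelfAdjoint
  set y : Unitization ℂ A := u.1 - 1 with hy
  have hyh : ‖h * y‖ ≤ e / 4 := (norm_mul_unitary_sub u hh.isSelfAdjoint).trans_le huh
  have h1 : ‖(1 - p) * y‖ ≤ 1 / 4 := by
    have : (1 - p) * y = q * (h * y) := by rw [hp', ← mul_assoc]; simp
    calc ‖(1 - p) * y‖ ≤ ‖q‖ * ‖h * y‖ := this ▸ norm_mul_le _ _
      _ ≤ e⁻¹ * (e / 4) := by gcongr
      _ = 1 / 4 := by field_simp
  have h2 : ‖y * (1 - p)‖ ≤ 1 / 4 := by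
    have : y * (1 - p) = y * h * q := by rw [hp, mul_assoc]; simp
    calc ‖y * (1 - p)‖ ≤ ‖y * h‖ * ‖q‖ := this ▸ norm_mul_le _ _
      _ ≤ (e / 4) * e⁻¹ := by gcongr
      _ = 1 / 4 := by field_simp
  obtain ⟨b, hb⟩ : ∃ b : A, p * y * p = (b : Unitization ℂ A) := by
    refine ⟨(p * y * p).snd, ?_⟩
    ext <;> simp [hy, sub_eq_add_neg, hu]
  have hbB : b ∈ selfAdjointAnnihilator k hks := by
    rw [mem_selfAdjointAnnihilator, ← hb]
    constructor
    · rw [mul_assoc, hpk, mul_zero]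
    · rw [mul_assoc, ← mul_assoc, hkp, zero_mul]
  set w : Unitization ℂ A := 1 + (b : Unitization ℂ A) with hw
  have hwu : ‖w - u.1‖ ≤ 1 / 2 := by
    have : w - u.1 = -((1 - p) * y * p + y * (1 - p)) := by
      rw [hw, ← hb, hy]; noncomm_ring
    rw [this, norm_neg]
    calc ‖(1 - p) * y * p + y * (1 - p)‖ ≤ ‖(1 - p) * y‖ * ‖p‖ + ‖y * (1 - p)‖ :=
          (norm_add_le _ _).trans (add_le_add_left (norm_mul_le _ _) _)
      _ ≤ 1 / 4 * 1 + 1 / 4 := by gcongr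
      _ = 1 / 2 := by norm_num
  have hseg : ∀ v ∈ segment ℝ u.1 w, IsUnit v := fun v hv =>
    isUnit_of_norm_sub_unitary_lt_one u
      ((norm_sub_le_of_mem_segment_of_le (by simp) hwu hv).trans_lt (by norm_num))
  have := isClosed_selfAdjointAnnihilator k hks
  obtain ⟨γ, hγ⟩ := hA.joinedIn_one (hereditary_selfAdjointAnnihilator k hks) hbB
    (hseg _ (right_mem_segment _ _ _))
  obtain ⟨C, hC⟩ := (isCompact_range γ.continuous).isBounded.exists_norm_le
  have hC' : ∀ t, ‖γ t - 1‖ ≤ C + ‖(1 : Unitization ℂ A)‖ := fun t =>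
    (norm_sub_le _ _).trans (add_le_add_left (hC _ ⟨t, rfl⟩) _)
  set D := max (C + ‖(1 : Unitization ℂ A)‖) 1
  have hD : 0 < D := lt_max_of_lt_right one_pos
  set η := e / D
  have hη : 0 < η := by positivity
  have hηD : η * D = e := div_mul_cancel₀ _ hD.ne'
  have hηe : η ≤ e := div_le_self he.le (le_max_right _ _)
  set m : Unitization ℂ A := k + algebraMap ℝ _ η with hm
  have hmpos : IsStrictlyPositive m := (isStrictlyPositive_algebraMap hη).nonneg_add hk
  have hmh : ‖m - h‖ ≤ 2 * e := by
    have : m - h = algebraMap ℝ _ η - (h - k) := by rw [hm]; abel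
    rw [this]
    refine (norm_sub_le _ _).trans ?_
    rw [norm_algebraMap', Real.norm_of_nonneg hη.le]
    linarith
  have hfix : ∀ c : A, c ∈ selfAdjointAnnihilator k hks →
      (1 + (c : Unitization ℂ A)) * m - m = η • (c : Unitization ℂ A) := by
    intro c hc
    rw [hm, add_mul, mul_add (c : Unitization ℂ A), hc.1, one_mul, ← Algebra.commutes,
      Algebra.smul_def]
    abel
  have hγm : ∀ t, ‖γ t * m - h‖ ≤ 6 * e := by
    intro t
    obtain ⟨-, c, hc, hct⟩ := hγ t
    have h3 : γ t * m - h = η • (γ t - 1) + (m - h) := by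
      have := hfix c hc
      rw [← hct] at this
      rw [show γ t - 1 = (c : Unitization ℂ A) by rw [hct]; abel, ← this]
      abel
    have h4 : ‖η • (γ t - 1)‖ ≤ e := by
      rw [norm_smul, Real.norm_of_nonneg hη.le, ← hηD]
      gcongr
      exact (hC' t).trans (le_max_left _ _)
    rw [h3]
    exact (norm_add_le _ _).trans (by linarith)
  have hum : ‖u.1 * m - h‖ ≤ 6 * e := by
    have h3 : u.1 * m - h = y * h + (u.1 * (m - h)) := by rw [hy]; noncomm_ring
    have h4 : ‖u.1 * (m - h)‖ = ‖m - h‖ := CStarRing.norm_coe_unitary_mul _ _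
    rw [h3]
    exact (norm_add_le _ _).trans (by linarith)
  have hwm : ‖w * m - h‖ ≤ 6 * e := by simpa using hγm 0
  refine ⟨m, hmpos, hmh, ?_⟩
  have J1 : JoinedIn {x : Unitization ℂ A | IsUnit x ∧ ‖x - h‖ ≤ 6 * e} (u.1 * m) (w * m) := by
    have := (JoinedIn.of_segment_subset (subset_refl (segment ℝ u.1 w))).map
      (f := fun x => x * m) (by fun_prop)
    refine this.mono ?_
    rintro _ ⟨v, hv, rfl⟩
    refine ⟨(hseg v hv).mul hmpos.isUnit, norm_sub_le_of_mem_segment_of_le hum hwm ?_⟩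
    obtain ⟨a, b, ha, hb, hab, rfl⟩ := hv
    exact ⟨a, b, ha, hb, hab, by simp only [add_mul, smul_mul_assoc]⟩
  have J2 : JoinedIn {x : Unitization ℂ A | IsUnit x ∧ ‖x - h‖ ≤ 6 * e} (w * m) m := by
    have : JoinedIn {x : Unitization ℂ A | IsUnit x ∧ ‖x - h‖ ≤ 6 * e} (w * m) (1 * m) :=
      ⟨γ.map (f := fun x => x * m) (by fun_prop), fun t =>
        ⟨(hγ t).1.mul hmpos.isUnit, hγm t⟩⟩
    rwa [one_mul] at this
  exact J1.trans J2

end AnnihilatorPath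

section Connecting

open Topology Unitization

variable {A : Type*} [NonUnitalCStarAlgebra A]

lemma Unitization.fst_abs_eq_one [PartialOrder (Unitization ℂ A)]
    [StarOrderedRing (Unitization ℂ A)] {g : Unitization ℂ A} (hg : g.fst = 1) :
    (CFC.abs g).fst = 1 := by
  obtain ⟨z, hz⟩ := CStarAlgebra.nonneg_iff_eq_star_mul_self.1 (CFC.abs_nonneg g)
  have h1 : (CFC.abs g).fst = (Complex.normSq z.fst : ℂ) := by
    rw [hz, Unitization.fst_mul, Unitization.fst_star, Complex.normSq_eq_conj_mul_self]
    rfl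
  have h2 := congrArg (fun x => x.fst) (CFC.abs_mul_abs g)
  simp only [Unitization.fst_mul, Unitization.fst_star, hg, star_one, mul_one, h1] at h2
  norm_cast at h2
  rw [h1]
  norm_cast
  nlinarith [Complex.normSq_nonneg z.fst]

lemma NoK1Obstructions.exists_joinedIn_of_norm_sub_le (hA : NoK1Obstructions A) {K ε : ℝ}
    (hK : 0 ≤ K) (hε : 0 < ε) :
    ∃ δ > 0, ∀ g₀ g₁ : Unitization ℂ A, IsUnit g₀ → IsUnit g₁ → g₀.fst = 1 → g₁.fst = 1 →
      ‖g₀‖ ≤ K → ‖g₁ - g₀‖ ≤ δ →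
      JoinedIn {x : Unitization ℂ A | IsUnit x ∧ ‖x - g₀‖ ≤ ε} g₁ g₀ := by
  let := CStarAlgebra.spectralOrder (Unitization ℂ A)
  let := CStarAlgebra.spectralOrderedRing (Unitization ℂ A)
  set e := ε / 6 with he_def
  have he : 0 < e := by positivity
  have hεe : ε = 6 * e := by rw [he_def]; ring
  refine ⟨min 1 (min (e / 8) ((e / 8) ^ 2 / (2 * K + 1))), by positivity, ?_⟩
  intro g₀ g₁ hu₀ hu₁ hf₀ hf₁ hgK hd
  have hd1 : ‖g₁ - g₀‖ ≤ 1 := hd.trans (min_le_left _ _)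
  have hd2 : ‖g₁ - g₀‖ ≤ e / 8 := hd.trans ((min_le_right _ _).trans (min_le_left _ _))
  have hd3 : ‖g₁ - g₀‖ * (2 * K + 1) ≤ (e / 8) ^ 2 := by
    rw [← le_div_iff₀ (by positivity)]
    exact hd.trans ((min_le_right _ _).trans (min_le_right _ _))
  obtain ⟨u₀, hg₀⟩ := hu₀.exists_unitary_mul_abs
  have hpos₀ := hu₀.isStrictlyPositive_abs
  have hfh := fst_abs_eq_one hf₀
  have hsq := CFC.abs_mul_abs g₀
  set h := CFC.abs g₀
  set g := star u₀.1 * g₁ with hg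
  have hgh : g - h = star u₀.1 * (g₁ - g₀) := by
    rw [mul_sub, ← hg]
    conv_rhs => rw [hg₀]
    rw [← mul_assoc, Unitary.star_mul_self_of_mem u₀.2, one_mul]
  have hgg : u₀.1 * g = g₁ := by
    rw [hg, ← mul_assoc, Unitary.mul_star_self_of_mem u₀.2, one_mul]
  have hghn : ‖g - h‖ ≤ e / 8 := by
    rw [hgh]
    exact (CStarRing.norm_coe_unitary_mul (star u₀) _).trans_le hd2
  have hug : IsUnit g := (Unitary.toUnits (star u₀)).isUnit.mul hu₁
  have hfu₀ : u₀.1.fst = 1 := by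
    have := congrArg (fun x => x.fst) hg₀
    simpa [hf₀, hfh] using this.symm
  have hfg : g.fst = 1 := by simp [hg, hfu₀, hf₁]
  obtain ⟨u, hu⟩ := hug.exists_unitary_mul_abs
  have hpos := hug.isStrictlyPositive_abs
  have hfm := fst_abs_eq_one hfg
  have habs : ‖CFC.abs g - h‖ ≤ e / 8 := by
    refine (norm_abs_sub_le g hpos₀.nonneg).trans ?_
    rw [Real.sqrt_le_left (by positivity)]
    have h1 : star g * g - h * h = star g₁ * (g₁ - g₀) + star (g₁ - g₀) * g₀ := by
      have : star g * g = star g₁ * g₁ := by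
        rw [hg, star_mul, star_star, mul_assoc, ← mul_assoc u₀.1,
          Unitary.mul_star_self_of_mem u₀.2, one_mul]
      rw [this, hsq, star_sub]
      noncomm_ring
    have h2 : ‖g₁‖ ≤ K + 1 := by
      have := norm_add_le (g₁ - g₀) g₀
      rw [sub_add_cancel] at this
      linarith
    rw [h1]
    calc _ ≤ ‖star g₁‖ * ‖g₁ - g₀‖ + ‖star (g₁ - g₀)‖ * ‖g₀‖ :=
          (norm_add_le _ _).trans (add_le_add (norm_mul_le _ _) (norm_mul_le _ _))
      _ ≤ (K + 1) * ‖g₁ - g₀‖ + ‖g₁ - g₀‖ * K := by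
          rw [norm_star, norm_star]; gcongr
      _ = ‖g₁ - g₀‖ * (2 * K + 1) := by ring
      _ ≤ _ := hd3
  set m₁ := CFC.abs g
  have hfu : u.1.fst = 1 := by
    have := congrArg (fun x => x.fst) hu
    simpa [hfg, hfm] using this.symm
  have huh : ‖(u.1 - 1) * h‖ ≤ e / 4 := by
    have h1 : (u.1 - 1) * h = u.1 * (h - m₁) + (g - h) := by
      conv_rhs => rw [hu]
      noncomm_ring
    rw [h1]
    refine (norm_add_le _ _).trans ?_
    rw [CStarRing.norm_coe_unitary_mul, norm_sub_rev]
    linarith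
  obtain ⟨m, hm, hmh, J⟩ := hA.exists_joinedIn_unitary_mul hfu hpos₀.nonneg he huh
  have hum := J.source_mem.2
  have J1 : JoinedIn {x : Unitization ℂ A | IsUnit x ∧ ‖x - h‖ ≤ 6 * e} g (u.1 * m) := by
    have := (JoinedIn.of_segment_subset (subset_refl (segment ℝ m₁ m))).map
      (f := fun x => u.1 * x) (by fun_prop)
    rw [hu]
    refine this.mono ?_
    rintro _ ⟨v, hv, rfl⟩
    refine ⟨(Unitary.toUnits u).isUnit.mul
      (convex_isStrictlyPositive.segment_subset hpos hm hv).isUnit,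
      norm_sub_le_of_mem_segment_of_le (x := u.1 * m₁) (y := u.1 * m) ?_ hum ?_⟩
    · rw [← hu]
      linarith
    · obtain ⟨a, b, ha, hb, hab, rfl⟩ := hv
      exact ⟨a, b, ha, hb, hab, by simp only [mul_add, mul_smul_comm]⟩
  have J2 : JoinedIn {x : Unitization ℂ A | IsUnit x ∧ ‖x - h‖ ≤ 6 * e} m h := by
    refine JoinedIn.of_segment_subset fun v hv => ⟨?_, ?_⟩
    · exact (convex_isStrictlyPositive.segment_subset hm hpos₀ hv).isUnit
    · refine norm_sub_le_of_mem_segment_of_le ?_ ?_ hv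
      · linarith
      · simp [he.le]
  have J3 := ((J1.trans J).trans J2).map (f := fun x => u₀.1 * x) (by fun_prop)
  rw [hgg, ← hg₀] at J3
  refine J3.mono ?_
  rintro _ ⟨v, ⟨hv1, hv2⟩, rfl⟩
  refine ⟨(Unitary.toUnits u₀).isUnit.mul hv1, ?_⟩
  rw [hg₀, ← mul_sub, CStarRing.norm_coe_unitary_mul, hεe]
  exact hv2

end Connecting

section Gluing

open Topology unitInterval

variable {E : Type*} [NormedAddCommGroup E] [NormedSpace ℝ E]

lemma exists_continuous_homogeneous_extension (c : C(I, E)) (h0 : c 0 = 0) (h1 : c 1 = 0) :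
    ∃ β : ℝ × ℝ → E, Continuous β ∧ (∀ s, β (s, 0) = 0) ∧ (∀ t, β (0, t) = 0) ∧
      ∀ t : I, β (1 - t, t) = c t := by
  let P : ℝ → I := Set.projIcc 0 1 zero_le_one
  have hP : Continuous P := continuous_projIcc
  refine ⟨fun p => (p.1 + p.2) • c (P (p.2 / (p.1 + p.2))), ?_, ?_, ?_, ?_⟩
  · refine continuous_iff_continuousAt.2 fun p => ?_
    by_cases hp : p.1 + p.2 = 0
    · rw [ContinuousAt, hp, zero_smul]
      have h : Filter.Tendsto (fun p : ℝ × ℝ => |p.1 + p.2| * ‖c‖) (𝓝 p) (𝓝 0) := by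
        have : Continuous fun p : ℝ × ℝ => |p.1 + p.2| * ‖c‖ := by fun_prop
        simpa [hp] using this.tendsto p
      refine squeeze_zero_norm (fun q => ?_) h
      rw [norm_smul, Real.norm_eq_abs]
      gcongr
      exact c.norm_coe_le_norm _
    · refine ContinuousAt.smul (by fun_prop) ?_
      refine (c.continuous.comp hP).continuousAt.comp ?_
      exact ContinuousAt.div (by fun_prop) (by fun_prop) hp
  · intro s
    have : P 0 = 0 := Set.projIcc_left _
    simp [this, h0]
  · intro t
    rcases eq_or_ne t 0 with rfl | ht
    · simp
    · have : P 1 = 1 := Set.projIcc_right _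
      simp [ht, this, h1]
  · intro t
    have : P t = t := Set.projIcc_val zero_le_one t
    simp [this]

variable {X : Type*} [TopologicalSpace X]

lemma exists_continuousMap_of_paths [NormalSpace X] {ι : Type*} [Fintype ι]
    [LinearOrder ι] {V : ι → Set X} (hVo : ∀ i, IsOpen (V i)) (hV : ⋃ i, V i = Set.univ)
    (hV2 : ∀ x i j k, x ∈ V i → x ∈ V j → x ∈ V k → i = j ∨ j = k ∨ i = k)
    (g : ι → E) (γ : ∀ i j, Path (g i) (g j)) :
    ∃ G : C(X, E), ∀ x, (∃ i, x ∈ V i ∧ G x = g i) ∨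
      ∃ i j t, x ∈ V i ∧ x ∈ V j ∧ G x = γ i j t := by
  obtain ⟨ρ, hρ⟩ := PartitionOfUnity.exists_isSubordinate_of_locallyFinite isClosed_univ V hVo
    (locallyFinite_of_finite V) hV.ge
  have hρV : ∀ i x, ρ i x ≠ 0 → x ∈ V i := fun i x h => hρ i (subset_tsupport _ h)
  have hρs : ∀ x, ∑ i, ρ i x = 1 := fun x => by
    rw [← finsum_eq_sum_of_fintype]
    exact ρ.sum_eq_one (Set.mem_univ x)
  choose β hβc hβ1 hβ2 hβ using fun i j => exists_continuous_homogeneous_extension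
    (⟨fun t : I => γ i j t - ((1 - (t : ℝ)) • g i + (t : ℝ) • g j), by fun_prop⟩ : C(I, E))
    (by simp) (by simp)
  let G : C(X, E) := ⟨fun x => ∑ i, ρ i x • g i +
    ∑ i, ∑ j, if i < j then β i j (ρ i x, ρ j x) else 0, by
      refine (continuous_finsetSum _ fun i _ => (ρ i).continuous.smul continuous_const).add
        (continuous_finsetSum _ fun i _ => continuous_finsetSum _ fun j _ => ?_)
      split_ifs
      · exact (hβc i j).comp ((ρ i).continuous.prodMk (ρ j).continuous)
      · exact continuous_const⟩
  have hG : ∀ x, G x = ∑ i, ρ i x • g i +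
    ∑ i, ∑ j, if i < j then β i j (ρ i x, ρ j x) else 0 := fun x => rfl
  refine ⟨G, fun x => ?_⟩
  rw [hG]
  have hex : ∃ i, ρ i x ≠ 0 := by
    by_contra! h
    have := hρs x
    simp [h] at this
  obtain ⟨i, hi⟩ := hex
  by_cases hj : ∃ j, j ≠ i ∧ ρ j x ≠ 0
  · obtain ⟨i, j, hij, hi, hj⟩ : ∃ i j, i < j ∧ ρ i x ≠ 0 ∧ ρ j x ≠ 0 := by
      obtain ⟨j, hne, hj⟩ := hj
      rcases hne.lt_or_gt with h | h
      · exact ⟨j, i, h, hj, hi⟩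
      · exact ⟨i, j, h, hi, hj⟩
    have hz : ∀ k, k ≠ i → k ≠ j → ρ k x = 0 := by
      intro k hki hkj
      by_contra hk
      rcases hV2 x i j k (hρV i x hi) (hρV j x hj) (hρV k x hk) with h | h | h
      · exact hij.ne h
      · exact hkj h.symm
      · exact hki h.symm
    have hsum : ρ i x + ρ j x = 1 := by
      rw [← hρs x, Fintype.sum_eq_add i j hij.ne fun k hk => hz k hk.1 hk.2]
    right
    refine ⟨i, j, ⟨ρ j x, ρ.nonneg j x, ρ.le_one j x⟩, hρV i x hi, hρV j x hj, ?_⟩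
    rw [Fintype.sum_eq_add i j hij.ne fun k hk => by rw [hz k hk.1 hk.2, zero_smul],
      Fintype.sum_eq_single i, Fintype.sum_eq_single j, if_pos hij]
    · have := hβ i j ⟨ρ j x, ρ.nonneg j x, ρ.le_one j x⟩
      rw [← eq_sub_iff_add_eq.2 hsum] at this
      rw [this]
      simp [← eq_sub_iff_add_eq.2 hsum]
    · intro k hk
      split_ifs with h
      · rw [hz k h.ne' hk, hβ1]
      · rfl
    · intro k hk
      refine Finset.sum_eq_zero fun l _ => ?_
      split_ifs with h
      · rcases eq_or_ne k j with rfl | hkj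
        · rw [hz l (hij.trans h).ne' h.ne', hβ1]
        · rw [hz k hk hkj, hβ2]
      · rfl
  · push Not at hj
    left
    refine ⟨i, hρV i x hi, ?_⟩
    have h1 : ρ i x = 1 := by rw [← hρs x, Fintype.sum_eq_single i hj]
    rw [Fintype.sum_eq_single i fun k hk => by rw [hj k hk, zero_smul], h1, one_smul,
      Finset.sum_eq_zero, add_zero]
    intro k _
    refine Finset.sum_eq_zero fun l _ => ?_
    split_ifs with h
    · rcases eq_or_ne k i with rfl | hk
      · rw [hj l h.ne', hβ1]
      · rw [hj k hk, hβ2]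
    · rfl

lemma CoveringDimLE.exists_refinement [CompactSpace X] (hX : CoveringDimLE X 1) {U : X → Set X}
    (hU : ∀ x, IsOpen (U x)) (hxU : ∀ x, x ∈ U x) :
    ∃ (n : ℕ) (V : Fin n → Set X), (∀ i, IsOpen (V i)) ∧ ⋃ i, V i = Set.univ ∧
      (∀ i, ∃ x, V i ⊆ U x) ∧
      ∀ x i j k, x ∈ V i → x ∈ V j → x ∈ V k → i = j ∨ j = k ∨ i = k := by
  classical
  obtain ⟨t, ht⟩ := isCompact_univ.elim_finite_subcover U hU fun x _ => Set.mem_iUnion.2 ⟨x, hxU x⟩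
  obtain ⟨𝒱, h1, h2, h3, h4⟩ := hX (t.image U)
    (by intro W hW; obtain ⟨x, -, rfl⟩ := Finset.mem_image.1 hW; exact hU x)
    (by
      refine Set.eq_univ_of_univ_subset (ht.trans ?_)
      simp)
  refine ⟨𝒱.card, fun i => (𝒱.equivFin.symm i).1, fun i => h1 _ (𝒱.equivFin.symm i).2, ?_, ?_, ?_⟩
  · rw [← h2, Set.sUnion_eq_iUnion]
    exact 𝒱.equivFin.symm.surjective.iUnion_comp (fun W : 𝒱 => W.1)
  · intro i
    obtain ⟨W, hW, hsub⟩ := h3 _ (𝒱.equivFin.symm i).2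
    obtain ⟨x, -, rfl⟩ := Finset.mem_image.1 hW
    exact ⟨x, hsub⟩
  · intro x i j k hi hj hk
    by_contra! hne
    have hfin : {V : Set X | V ∈ 𝒱 ∧ x ∈ V}.Finite := 𝒱.finite_toSet.subset fun V hV => hV.1
    have hinj : ∀ {a b}, (𝒱.equivFin.symm a).1 = (𝒱.equivFin.symm b).1 → a = b := fun h =>
      𝒱.equivFin.symm.injective (Subtype.ext h)
    have : 2 < {V : Set X | V ∈ 𝒱 ∧ x ∈ V}.ncard := (Set.two_lt_ncard_iff hfin).2
      ⟨_, _, _, ⟨(𝒱.equivFin.symm i).2, hi⟩, ⟨(𝒱.equivFin.symm j).2, hj⟩,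
        ⟨(𝒱.equivFin.symm k).2, hk⟩, fun h => hne.1 (hinj h), fun h => hne.2.2 (hinj h),
        fun h => hne.2.1 (hinj h)⟩
    have := h4 x
    omega

end Gluing

section Main

open Topology Unitization

variable {A : Type*} [NonUnitalCStarAlgebra A]

lemma Unitization.norm_fst_le (x : Unitization ℂ A) : ‖x.fst‖ ≤ ‖x‖ := by
  rw [Unitization.norm_eq_sup]
  exact le_sup_left

lemma Unitization.norm_snd_le (x : Unitization ℂ A) : ‖x.snd‖ ≤ 2 * ‖x‖ := by
  have h1 : (x.snd : Unitization ℂ A) = x - x.fst • (1 : Unitization ℂ A) := by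
    ext <;> simp [sub_eq_add_neg]
  rw [← norm_inr (𝕜 := ℂ) x.snd, h1]
  refine (norm_sub_le _ _).trans ?_
  rw [norm_smul, CStarRing.norm_one]
  linarith [norm_fst_le x]

variable {X : Type*} [TopologicalSpace X] [CompactSpace X]

lemma isUnit_one_add_inr_continuousMap (f : C(X, A))
    (hf : ∀ x, IsUnit (1 + (f x : Unitization ℂ A))) :
    IsUnit (1 + (f : Unitization ℂ C(X, A))) := by
  rw [isUnit_one_add_inr_iff_exists]
  let v : X → Unitization ℂ A := fun x => Ring.inverse (1 + (f x : Unitization ℂ A))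
  have hv : Continuous v := by
    refine continuous_iff_continuousAt.2 fun x => ?_
    obtain ⟨c, hc⟩ := hf x
    have h1 : ContinuousAt Ring.inverse (1 + (f x : Unitization ℂ A)) :=
      hc ▸ NormedRing.inverse_continuousAt c
    exact ContinuousAt.comp (f := fun x => 1 + (f x : Unitization ℂ A)) h1 (continuous_const.add
      (Unitization.continuous_inr.comp f.continuous)).continuousAt
  have h1 : ∀ x, (1 + (f x : Unitization ℂ A)) * v x = 1 := fun x => Ring.mul_inverse_cancel _ (hf x)
  have h2 : ∀ x, v x * (1 + (f x : Unitization ℂ A)) = 1 := fun x => Ring.inverse_mul_cancel _ (hf x)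
  have h3 : ∀ x, (v x).fst = 1 := fun x => by
    have := congrArg (fun x => x.fst) (h1 x)
    simpa using this
  refine ⟨⟨fun x => (v x).snd, Unitization.continuous_snd.comp hv⟩, ?_, ?_⟩
  · ext x
    have := congrArg (fun x => x.snd) (h1 x)
    simp only [add_mul, one_mul, Unitization.snd_add, Unitization.snd_mul, h3, Unitization.fst_inr,
      Unitization.snd_inr, Unitization.snd_one, zero_smul, one_smul, zero_add] at this
    simp only [ContinuousMap.add_apply, ContinuousMap.mul_apply, ContinuousMap.coe_mk,
      ContinuousMap.zero_apply]
    rw [← this]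
    abel
  · ext x
    have := congrArg (fun x => x.snd) (h2 x)
    simp only [mul_add, mul_one, Unitization.snd_add, Unitization.snd_mul, h3, Unitization.fst_inr,
      Unitization.snd_inr, Unitization.snd_one, zero_smul, one_smul, add_zero] at this
    simp only [ContinuousMap.add_apply, ContinuousMap.mul_apply, ContinuousMap.coe_mk,
      ContinuousMap.zero_apply]
    rw [← this]
    abel

lemma NoK1Obstructions.exists_isUnit_continuousMap [NormalSpace X] (hA : NoK1Obstructions A)
    (hX : CoveringDimLE X 1) (f : C(X, A)) {ε : ℝ} (hε : 0 < ε) :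
    ∃ G : C(X, Unitization ℂ A), ∀ x, IsUnit (G x) ∧
      ‖G x - (1 + (f x : Unitization ℂ A))‖ ≤ ε := by
  set K := ‖(1 : Unitization ℂ A)‖ + ‖f‖ + 1
  obtain ⟨δ, hδ, hconn⟩ := hA.exists_joinedIn_of_norm_sub_le (K := K) (by positivity) (half_pos hε)
  set d := min (min δ ε) 1
  have hd : 0 < d := by positivity
  have hdδ : d ≤ δ := (min_le_left _ _).trans (min_le_left _ _)
  have hdε : d ≤ ε := (min_le_left _ _).trans (min_le_right _ _)
  have hd1 : d ≤ 1 := min_le_right _ _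
  obtain ⟨n, V, hVo, hV, hVU, hV2⟩ := hX.exists_refinement
    (U := fun x => {y | ‖f y - f x‖ < d / 4})
    (fun x => isOpen_lt (by fun_prop) continuous_const) (fun x => by simpa using hd)
  choose z hz using hVU
  choose a ha hau using fun i => stableRankOne_iff.1 hA.1 (f (z i)) (d / 4) (by positivity)
  let g : Fin n → Unitization ℂ A := fun i => 1 + (a i : Unitization ℂ A)
  have hnear : ∀ i, ∀ x ∈ V i, ‖g i - (1 + (f x : Unitization ℂ A))‖ ≤ d / 2 := by
    intro i x hx
    have h1 : g i - (1 + (f x : Unitization ℂ A)) =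
        ((a i - f (z i) - (f x - f (z i)) : A) : Unitization ℂ A) := by
      simp [g]
    rw [h1, norm_inr]
    have h2 : ‖f x - f (z i)‖ < d / 4 := hz i hx
    exact (norm_sub_le _ _).trans (by linarith [ha i])
  have hgK : ∀ i, ‖g i‖ ≤ K := by
    intro i
    have h1 : ‖a i‖ ≤ ‖f‖ + 1 := by
      have h2 := norm_add_le (a i - f (z i)) (f (z i))
      rw [sub_add_cancel] at h2
      linarith [ha i, f.norm_coe_le_norm (z i)]
    refine (norm_add_le _ _).trans ?_
    rw [norm_inr]
    simp only [K]
    linarith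
  have hpath : ∀ i j, ∃ γ : Path (g i) (g j), ∀ x, x ∈ V i → x ∈ V j →
      ∀ t, IsUnit (γ t) ∧ ‖γ t - g j‖ ≤ ε / 2 := by
    intro i j
    by_cases hij : ∃ x, x ∈ V i ∧ x ∈ V j
    · obtain ⟨x, hxi, hxj⟩ := hij
      obtain ⟨γ, hγ⟩ := hconn (g j) (g i) (hau j) (hau i) (by simp [g]) (by simp [g]) (hgK j) (by
        have : g i - g j = (g i - (1 + (f x : Unitization ℂ A))) -
          (g j - (1 + (f x : Unitization ℂ A))) := by abel
        rw [this]
        refine (norm_sub_le _ _).trans ?_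
        linarith [hnear i x hxi, hnear j x hxj])
      exact ⟨γ, fun _ _ _ t => hγ t⟩
    · exact ⟨PathConnectedSpace.somePath _ _, fun x hi hj => (hij ⟨x, hi, hj⟩).elim⟩
  choose γ hγ using hpath
  obtain ⟨G, hG⟩ := exists_continuousMap_of_paths hVo hV hV2 g γ
  refine ⟨G, fun x => ?_⟩
  rcases hG x with ⟨i, hi, h⟩ | ⟨i, j, t, hi, hj, h⟩
  · rw [h]
    exact ⟨hau i, (hnear i x hi).trans (by linarith)⟩
  · rw [h]
    obtain ⟨h1, h2⟩ := hγ i j x hi hj t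
    refine ⟨h1, ?_⟩
    have := norm_add_le (γ i j t - g j) (g j - (1 + (f x : Unitization ℂ A)))
    rw [sub_add_sub_cancel] at this
    linarith [hnear j x hj]

lemma NoK1Obstructions.stableRankOne_continuousMap [NormalSpace X] (hA : NoK1Obstructions A)
    (hX : CoveringDimLE X 1) : StableRankOne C(X, A) := by
  rw [stableRankOne_iff]
  intro f ε hε
  set r := min (1 / 2) (ε / (4 * (2 + ‖f‖))) with hr_def
  have hr : 0 < r := by positivity
  have hr1 : r ≤ 1 / 2 := min_le_left _ _
  have hr2 : r * (4 * (2 + ‖f‖)) ≤ ε := by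
    rw [← le_div_iff₀ (by positivity)]
    exact min_le_right _ _
  obtain ⟨G, hG⟩ := hA.exists_isUnit_continuousMap hX f hr
  have hs : ∀ x, (G x).fst ≠ 0 := fun x => fst_ne_zero_of_isUnit (hG x).1
  let f' : C(X, A) := ⟨fun x => (G x).fst⁻¹ • (G x).snd,
    ((Unitization.continuous_fst.comp G.continuous).inv₀ hs).smul
      (Unitization.continuous_snd.comp G.continuous)⟩
  refine ⟨f', ?_, isUnit_one_add_inr_continuousMap f' fun x => isUnit_one_add_inr_snd (hG x).1⟩
  refine lt_of_le_of_lt ((ContinuousMap.norm_le _ (by positivity : 0 ≤ ε / 2)).2 fun x => ?_)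
    (half_lt_self hε)
  obtain ⟨ρ, hρ⟩ : ∃ ρ, G x = 1 + (f x : Unitization ℂ A) + ρ := ⟨_, (add_sub_cancel _ _).symm⟩
  have hρr : ‖ρ‖ ≤ r := by simpa [hρ] using (hG x).2
  have h1 : (G x).fst = 1 + ρ.fst := by simp [hρ]
  have h2 : (G x).snd = f x + ρ.snd := by simp [hρ]
  have hρ1 := norm_fst_le ρ
  have hρ2 := norm_snd_le ρ
  have h3 : 1 / 2 ≤ ‖1 + ρ.fst‖ := by
    have := norm_sub_norm_le (1 : ℂ) (-ρ.fst)
    rw [norm_one, norm_neg, sub_neg_eq_add] at this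
    linarith
  have h4 : (f' - f) x = (1 + ρ.fst)⁻¹ • (ρ.snd - ρ.fst • f x) := by
    have h5 : (1 + ρ.fst) ≠ 0 := h1 ▸ hs x
    rw [eq_inv_smul_iff₀ h5]
    simp only [ContinuousMap.sub_apply, f', ContinuousMap.coe_mk, h1, h2]
    rw [smul_sub, smul_inv_smul₀ h5, add_smul, one_smul]
    abel
  rw [h4, norm_smul, norm_inv]
  calc ‖1 + ρ.fst‖⁻¹ * ‖ρ.snd - ρ.fst • f x‖
      ≤ (1 / 2)⁻¹ * (2 * r + r * ‖f‖) := by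
        gcongr
        refine (norm_sub_le _ _).trans (add_le_add (by linarith) ?_)
        rw [norm_smul]
        exact mul_le_mul (by linarith) (f.norm_coe_le_norm x) (norm_nonneg _) hr.le
    _ ≤ ε / 2 := by linarith

end Main

theorem stmt4 (A : Type*) [NonUnitalCStarAlgebra A] [TopologicalSpace.SeparableSpace A]
    (hA : NoK1Obstructions A) (X : Type*) [MetricSpace X] [CompactSpace X]
    (hX : CoveringDimEq X 1) :
    StableRankOne C(X, A) := by
  exact hA.stableRankOne_continuousMap hX.1
end
end

section
/- Let A be any C*-algebra and let X be a compact metric space with covering dimension equal to one. If C(X,A) has stable rank one, then A has no K₁-obstructions. -/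
noncomputable section

set_option maxHeartbeats 1000000

open Topology Filter Set

theorem coveringDimLE_zero_of_totallyDisconnected (X : Type*) [TopologicalSpace X] [T2Space X]
    [CompactSpace X] [TotallyDisconnectedSpace X] : CoveringDimLE X 0 := by
  classical
  intro 𝒰 hopen hcover
  have hex : ∀ x : X, ∃ V : Set X, IsClopen V ∧ x ∈ V ∧ ∃ U ∈ 𝒰, V ⊆ U := by
    intro x
    obtain ⟨U, hU, hxU⟩ : x ∈ ⋃₀ (𝒰 : Set (Set X)) := hcover ▸ mem_univ x
    obtain ⟨V, hV, hxV, hVU⟩ := compact_exists_isClopen_in_isOpen (hopen U hU) hxU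
    exact ⟨V, hV, hxV, U, hU, hVU⟩
  choose V hV hxV W hW hVW using hex
  obtain ⟨t, ht⟩ := isCompact_univ.elim_finite_subcover V (fun x => (hV x).isOpen)
    (fun x _ => mem_iUnion.2 ⟨x, hxV x⟩)
  obtain ⟨e⟩ : Nonempty (Fin t.card ≃ t) := ⟨t.equivFin.symm⟩
  let P : Fin t.card → Set X := fun i => V (e i) \ ⋃ j : {j // j < i}, V (e j)
  refine ⟨Finset.univ.image P, ?_, ?_, ?_, ?_⟩
  · simp only [Finset.mem_image, Finset.mem_univ, true_and, forall_exists_index,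
      forall_apply_eq_imp_iff]
    exact fun i => ((hV _).diff (isClopen_iUnion_of_finite fun j => hV _)).isOpen
  · refine eq_univ_of_forall fun x => ?_
    have hx : ∃ i, x ∈ V (e i) := by
      obtain ⟨y, hy, hxy⟩ := mem_iUnion₂.1 (ht (mem_univ x))
      exact ⟨e.symm ⟨y, hy⟩, by simpa using hxy⟩
    have hne : (Finset.univ.filter fun i => x ∈ V (e i)).Nonempty := by
      obtain ⟨i, hi⟩ := hx
      exact ⟨i, by simpa using hi⟩
    have hmem := Finset.min'_mem _ hne
    refine ⟨P (Finset.min' _ hne), by simp, (Finset.mem_filter.1 hmem).2, ?_⟩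
    simp only [mem_iUnion, not_exists]
    rintro ⟨j, hj⟩ hxj
    exact absurd (Finset.min'_le _ j (by simpa using hxj)) (not_le.2 hj)
  · simp only [Finset.mem_image, Finset.mem_univ, true_and, forall_exists_index,
      forall_apply_eq_imp_iff]
    exact fun i => ⟨_, hW _, sdiff_subset.trans (hVW _)⟩
  · intro x
    have hfin : {V : Set X | V ∈ Finset.univ.image P ∧ x ∈ V}.Finite :=
      (Finset.finite_toSet (Finset.univ.image P)).subset fun V hV => hV.1
    rw [zero_add, ncard_le_one hfin]
    simp only [mem_ofPred_eq, Finset.mem_image, Finset.mem_univ, true_and]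
    rintro _ ⟨⟨i, rfl⟩, hi⟩ _ ⟨⟨j, rfl⟩, hj⟩
    rcases lt_trichotomy i j with hij | rfl | hij
    · exact absurd (mem_iUnion.2 ⟨⟨i, hij⟩, hi.1⟩) hj.2
    · rfl
    · exact absurd (mem_iUnion.2 ⟨⟨j, hij⟩, hj.1⟩) hi.2

theorem Unitization.continuous_starMap {A B : Type*} [NonUnitalCStarAlgebra A]
    [NonUnitalCStarAlgebra B] (φ : A →⋆ₙₐ[ℂ] B) (hφ : Continuous φ) :
    Continuous (Unitization.starMap φ) := by
  have h : ⇑(Unitization.starMap φ) = fun x : Unitization ℂ A =>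
      algebraMap ℂ (Unitization ℂ B) x.fst + (φ x.snd : Unitization ℂ B) := by
    ext x <;> simp
  rw [h]
  exact ((continuous_algebraMap ℂ _).comp Unitization.continuous_fst).add
    (Unitization.continuous_inr.comp (hφ.comp Unitization.continuous_snd))

/-- Stable rank one passes to quotients. -/
theorem StableRankOne.of_surjective {A B : Type*} [NonUnitalCStarAlgebra A]
    [NonUnitalCStarAlgebra B] (h : StableRankOne A) (φ : A →⋆ₙₐ[ℂ] B) (hφ : Continuous φ)
    (hsurj : Function.Surjective φ) : StableRankOne B := by
  intro y
  obtain ⟨a, ha⟩ := hsurj y.snd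
  have hy : Unitization.starMap φ (.inl y.fst + .inr a) = y := by
    ext <;> simp [ha, Unitization.algebraMap_eq_inl]
  rw [← hy]
  exact map_mem_closure (Unitization.continuous_starMap φ hφ) (h _) fun x hx => hx.map _

/-- Evaluation at a point, as a star homomorphism. -/
def evalStarHom {X : Type*} [TopologicalSpace X] [CompactSpace X] (A : Type*)
    [NonUnitalCStarAlgebra A] (x : X) : C(X, A) →⋆ₙₐ[ℂ] A where
  toFun f := f x
  map_smul' _ _ := rfl
  map_zero' := rfl
  map_add' _ _ := rfl
  map_mul' _ _ := rfl
  map_star' _ := rfl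

/-- Postcomposition with the inclusion of a closed star subalgebra. -/
def compInclusion (X : Type*) [TopologicalSpace X] [CompactSpace X] {A : Type*}
    [NonUnitalCStarAlgebra A] (B : NonUnitalStarSubalgebra ℂ A) [IsClosed (B : Set A)] :
    C(X, B) →⋆ₙₐ[ℂ] C(X, A) where
  toFun f := ⟨fun x => (f x : A), continuous_subtype_val.comp f.continuous⟩
  map_smul' _ _ := rfl
  map_zero' := rfl
  map_add' _ _ := rfl
  map_mul' _ _ := rfl
  map_star' _ := rfl

theorem isometry_compInclusion (X : Type*) [TopologicalSpace X] [CompactSpace X] {A : Type*}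
    [NonUnitalCStarAlgebra A] (B : NonUnitalStarSubalgebra ℂ A) [IsClosed (B : Set A)] :
    Isometry (compInclusion X B) := by
  refine AddMonoidHomClass.isometry_of_norm _ fun f => ?_
  refine le_antisymm ?_ ?_
  · exact (ContinuousMap.norm_le _ (norm_nonneg f)).2 fun x => f.norm_coe_le_norm x
  · exact (ContinuousMap.norm_le _ (norm_nonneg _)).2
      fun x => (compInclusion X B f).norm_coe_le_norm x

/-- A C⋆-algebra embedded with hereditary range in one of stable rank one has stable rank one. -/
theorem StableRankOne.of_hereditary_s5 {A B : Type*} [NonUnitalCStarAlgebra A]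
    [NonUnitalCStarAlgebra B] (h : StableRankOne A) (φ : B →⋆ₙₐ[ℂ] A) (hφ : Isometry φ)
    (hher : ∀ b a b', ∃ c, φ c = φ b * a * φ b') : StableRankOne B := by
  have hher' : ∀ (b : B) (y : Unitization ℂ A) (b' : B), ∃ c : B,
      ((φ c : A) : Unitization ℂ A) = (φ b : Unitization ℂ A) * y * (φ b' : Unitization ℂ A) := by
    intro b y b'
    obtain ⟨c, hc⟩ := hher b y.snd b'
    refine ⟨y.fst • (b * b') + c, ?_⟩
    ext <;> simp [hc, add_mul, smul_mul_assoc]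
  have hinj : Function.Injective (Unitization.starMap φ) := by
    intro x y hxy
    have h1 := congrArg (fun z => z.fst) hxy
    have h2 := congrArg (fun z => z.snd) hxy
    ext
    · simpa [Unitization.algebraMap_eq_inl] using h1
    · exact hφ.injective (by simpa [Unitization.algebraMap_eq_inl] using h2)
  have key : ∀ e b : B, (1 + (e * b : B) : Unitization ℂ B) ∈
      closure {x : Unitization ℂ B | IsUnit x} := by
    intro e b
    choose c hc using fun y => hher' e y b
    have hcc : Continuous c := by
      have : Topology.IsInducing fun z : B => (φ z : Unitization ℂ A) :=
        ((Unitization.isometry_inr (𝕜 := ℂ)).comp hφ).isEmbedding.isInducing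
      rw [this.continuous_iff]
      simp only [Function.comp_def, hc]
      fun_prop
    have hc1 : c 1 = e * b := by
      apply hφ.injective
      apply Unitization.inr_injective (R := ℂ)
      rw [hc, mul_one, map_mul, Unitization.inr_mul]
    set w : Unitization ℂ A := (φ b : Unitization ℂ A) * (φ e : Unitization ℂ A) with hw
    have htends : Tendsto (fun g : Unitization ℂ A =>
        (1 + (c (Ring.inverse (g - w)) : B) : Unitization ℂ B)) (𝓝 (1 + w))
        (𝓝 (1 + (e * b : B))) := by
      have h1 : Tendsto (fun g : Unitization ℂ A => g - w) (𝓝 (1 + w))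
          (𝓝 ((1 : (Unitization ℂ A)ˣ) : Unitization ℂ A)) := by
        have : Continuous fun g : Unitization ℂ A => g - w := by fun_prop
        simpa using this.tendsto (1 + w)
      have h2 := (NormedRing.inverse_continuousAt (1 : (Unitization ℂ A)ˣ)).tendsto.comp h1
      have h3 : Continuous fun y => (1 + (c y : B) : Unitization ℂ B) :=
        continuous_const.add (Unitization.continuous_inr.comp hcc)
      have h4 := (h3.tendsto _).comp h2
      simpa [Function.comp_def, hc1] using h4
    refine mem_closure_of_frequently_of_tendsto (b := 𝓝 (1 + w)) ?_ htends
    have hfreq : ∃ᶠ g in 𝓝 (1 + w), IsUnit g := mem_closure_iff_frequently.1 (h (1 + w))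
    have hev : ∀ᶠ g in 𝓝 (1 + w), IsUnit (g - w) := by
      have : Continuous fun g : Unitization ℂ A => g - w := by fun_prop
      refine this.continuousAt.eventually (Units.isOpen.mem_nhds ?_)
      simp
    refine (hfreq.and_eventually hev).mono ?_
    rintro g ⟨⟨g, rfl⟩, ⟨d, hd⟩⟩
    rw [← hd, Ring.inverse_unit]
    have hgw : w = g - d := by rw [hd]; abel
    have h1 : (↑d⁻¹ * w * ↑g⁻¹ : Unitization ℂ A) = ↑d⁻¹ - ↑g⁻¹ := by
      rw [hgw, mul_sub, sub_mul, mul_assoc, Units.mul_inv, Units.inv_mul, mul_one, one_mul]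
    have h2 : (↑g⁻¹ * w * ↑d⁻¹ : Unitization ℂ A) = ↑d⁻¹ - ↑g⁻¹ := by
      rw [hgw, mul_sub, sub_mul, mul_assoc _ (d : Unitization ℂ A), Units.mul_inv, Units.inv_mul,
        mul_one, one_mul]
    refine isUnit_iff_exists.2 ⟨1 - (c (g⁻¹ : (Unitization ℂ A)ˣ) : B), ?_, ?_⟩
    · apply hinj
      simp only [map_mul, map_add, map_sub, map_one, Unitization.starMap_inr, hc]
      calc _ = 1 + (φ e : Unitization ℂ A) * ↑d⁻¹ * (φ b : Unitization ℂ A)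
            - (φ e : Unitization ℂ A) * ↑g⁻¹ * (φ b : Unitization ℂ A)
            - (φ e : Unitization ℂ A) * (↑d⁻¹ * w * ↑g⁻¹) * (φ b : Unitization ℂ A) := by
              rw [hw]; noncomm_ring
        _ = 1 := by rw [h1]; noncomm_ring
    · apply hinj
      simp only [map_mul, map_add, map_sub, map_one, Unitization.starMap_inr, hc]
      calc _ = 1 + (φ e : Unitization ℂ A) * ↑d⁻¹ * (φ b : Unitization ℂ A)
            - (φ e : Unitization ℂ A) * ↑g⁻¹ * (φ b : Unitization ℂ A)
            - (φ e : Unitization ℂ A) * (↑g⁻¹ * w * ↑d⁻¹) * (φ b : Unitization ℂ A) := by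
              rw [hw]; noncomm_ring
        _ = 1 := by rw [h2]; noncomm_ring
  have key_one : ∀ b : B, (1 + b : Unitization ℂ B) ∈ closure {x : Unitization ℂ B | IsUnit x} := by
    intro b
    let := CStarAlgebra.spectralOrder B
    have := CStarAlgebra.spectralOrderedRing B
    have hlim := (CStarAlgebra.increasingApproximateUnit B).tendsto_mul_right b
    have hcont : Continuous fun z : B => (1 + z : Unitization ℂ B) :=
      continuous_const.add Unitization.continuous_inr
    exact isClosed_closure.mem_of_tendsto ((hcont.tendsto b).comp hlim)
      (Eventually.of_forall fun e => key e b)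
  have key_ne : ∀ (z : ℂ) (b : B), z ≠ 0 →
      (algebraMap ℂ (Unitization ℂ B) z + b) ∈ closure {x : Unitization ℂ B | IsUnit x} := by
    intro z b hz
    have heq : algebraMap ℂ (Unitization ℂ B) z + b =
        algebraMap ℂ (Unitization ℂ B) z * (1 + (z⁻¹ • b : B)) := by
      rw [mul_add, mul_one, ← Algebra.smul_def, ← Unitization.inr_smul, smul_inv_smul₀ hz]
    rw [heq]
    exact map_mem_closure (continuous_const_mul _) (key_one _)
      fun x hx => ((isUnit_iff_ne_zero.2 hz).map (algebraMap ℂ (Unitization ℂ B))).mul hx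
  intro x
  have hcont : Continuous fun z : ℂ => algebraMap ℂ (Unitization ℂ B) z + x.snd :=
    (continuous_algebraMap ℂ _).add continuous_const
  have hx : algebraMap ℂ (Unitization ℂ B) x.fst + x.snd = x := by
    ext <;> simp [Unitization.algebraMap_eq_inl]
  rw [← hx, ← closure_closure]
  exact map_mem_closure (f := fun z : ℂ => algebraMap ℂ (Unitization ℂ B) z + x.snd) hcont
    (dense_compl_singleton (0 : ℂ) x.fst) fun z hz => key_ne z _ hz

/-- If units are dense in two matrix rings, they are dense in the ring of block matrices. -/
theorem Matrix.dense_isUnit_fromBlocks {R m n : Type*} [Ring R] [TopologicalSpace R]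
    [IsTopologicalRing R] [Fintype m] [Fintype n] [DecidableEq m] [DecidableEq n]
    (hm : Dense {M : Matrix m m R | IsUnit M}) (hn : Dense {M : Matrix n n R | IsUnit M}) :
    Dense {M : Matrix (m ⊕ n) (m ⊕ n) R | IsUnit M} := by
  have hblock : ∀ (a : (Matrix m m R)ˣ) (b : Matrix m n R) (c : Matrix n m R) (s : Matrix n n R),
      IsUnit s → IsUnit (Matrix.fromBlocks a.1 b c (c * (a⁻¹).1 * b + s)) := by
    intro a b c s hs
    obtain ⟨s, rfl⟩ := hs
    have hL : IsUnit (Matrix.fromBlocks (1 : Matrix m m R) 0 (c * (a⁻¹).1) (1 : Matrix n n R)) :=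
      isUnit_iff_exists.2 ⟨Matrix.fromBlocks 1 0 (-(c * (a⁻¹).1)) 1,
        by simp [Matrix.fromBlocks_multiply], by simp [Matrix.fromBlocks_multiply]⟩
    have hD : IsUnit (Matrix.fromBlocks a.1 0 0 s.1) :=
      isUnit_iff_exists.2 ⟨Matrix.fromBlocks (a⁻¹).1 0 0 (s⁻¹).1,
        by simp [Matrix.fromBlocks_multiply], by simp [Matrix.fromBlocks_multiply]⟩
    have hU : IsUnit (Matrix.fromBlocks (1 : Matrix m m R) ((a⁻¹).1 * b) 0 (1 : Matrix n n R)) :=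
      isUnit_iff_exists.2 ⟨Matrix.fromBlocks 1 (-((a⁻¹).1 * b)) 0 1,
        by simp [Matrix.fromBlocks_multiply], by simp [Matrix.fromBlocks_multiply]⟩
    convert (hL.mul hD).mul hU using 1
    have h1 : c * (a⁻¹).1 * a.1 = c := by
      rw [Matrix.mul_assoc, Units.inv_mul, Matrix.mul_one]
    have h2 : a.1 * ((a⁻¹).1 * b) = b := by
      rw [← Matrix.mul_assoc, Units.mul_inv, Matrix.one_mul]
    simp [Matrix.fromBlocks_multiply, h1, h2, Matrix.mul_assoc]
  intro M
  obtain ⟨a, b, c, d, rfl⟩ : ∃ a b c d, M = Matrix.fromBlocks a b c d :=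
    ⟨_, _, _, _, (Matrix.fromBlocks_toBlocks M).symm⟩
  rw [← closure_closure]
  refine map_mem_closure (f := fun a => Matrix.fromBlocks a b c d) (by fun_prop) (hm a) ?_
  rintro _ ⟨a, rfl⟩
  have hcont : Continuous fun s => Matrix.fromBlocks a.1 b c (c * (a⁻¹).1 * b + s) := by fun_prop
  have := map_mem_closure (t := {M : Matrix (m ⊕ n) (m ⊕ n) R | IsUnit M}) hcont
    (hn (d - c * (a⁻¹).1 * b)) fun s hs => hblock a b c s hs
  simpa using this

theorem Matrix.dense_isUnit_fin {R : Type*} [Ring R] [TopologicalSpace R]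
    [IsTopologicalRing R] (hR : Dense {x : R | IsUnit x}) (n : ℕ) :
    Dense {M : Matrix (Fin n) (Fin n) R | IsUnit M} := by
  have hone : Dense {M : Matrix (Fin 1) (Fin 1) R | IsUnit M} := by
    intro M
    have hM : M = Matrix.diagonal fun _ => M 0 0 := by
      ext i j; simp [Subsingleton.elim i 0, Subsingleton.elim j 0]
    rw [hM]
    refine map_mem_closure (f := fun x => Matrix.diagonal fun _ : Fin 1 => x) (by fun_prop)
      (hR (M 0 0)) fun x hx => ?_
    exact IsUnit.map (Matrix.scalar (Fin 1)) hx
  induction n with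
  | zero => exact fun M => subset_closure (isUnit_of_subsingleton M)
  | succ n ih =>
    intro M
    have h := Matrix.dense_isUnit_fromBlocks ih hone
      (Matrix.reindex finSumFinEquiv.symm finSumFinEquiv.symm M)
    have := map_mem_closure (f := Matrix.reindex finSumFinEquiv finSumFinEquiv)
      (t := {M : Matrix (Fin (n + 1)) (Fin (n + 1)) R | IsUnit M}) ?_ h ?_
    · simpa using this
    · exact continuous_id.matrix_reindex _ _
    · intro x hx
      exact IsUnit.map (Matrix.reindexRingEquiv R finSumFinEquiv) hx

/-- The invertible complex matrices are connected. -/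
theorem Matrix.exists_isPreconnected_isUnit {n : Type*} [Fintype n] [DecidableEq n]
    {v : Matrix n n ℂ} (hv : IsUnit v) :
    ∃ S : Set (Matrix n n ℂ), IsPreconnected S ∧ (∀ M ∈ S, IsUnit M) ∧ 1 ∈ S ∧ v ∈ S := by
  let P : Polynomial ℂ := (1 + (Polynomial.X : Polynomial ℂ) • (v - 1).map Polynomial.C).det
  have hP : ∀ z : ℂ, P.eval z = (1 + z • (v - 1)).det := by
    intro z
    simp only [P]
    rw [← Polynomial.coe_evalRingHom, RingHom.map_det]
    congr 1
    ext i j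
    by_cases h : i = j
    · subst h
      simp
    · simp [h]
      exact mul_comm _ _
  have hP0 : P ≠ 0 := by
    intro h
    have := hP 0
    simp [h] at this
  have hconn : IsPreconnected {z : ℂ | P.eval z = 0}ᶜ := by
    have hfin : {z : ℂ | P.eval z = 0}.Finite := Polynomial.finite_setOfPred_isRoot hP0
    exact (hfin.countable.isPathConnected_compl_of_one_lt_rank
      (by rw [Complex.rank_real_complex]; norm_num)).isConnected.isPreconnected
  refine ⟨(fun z : ℂ => 1 + z • (v - 1)) '' {z : ℂ | P.eval z = 0}ᶜ,
    hconn.image _ (by fun_prop), ?_, ⟨0, ?_, by simp⟩, ⟨1, ?_, by simp⟩⟩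
  · rintro _ ⟨z, hz, rfl⟩
    rw [Matrix.isUnit_iff_isUnit_det, ← hP]
    exact isUnit_iff_ne_zero.2 hz
  · simp [hP]
  · simpa [hP] using ((Matrix.isUnit_iff_isUnit_det v).1 hv).ne_zero

section UnitaryPart

variable {D : Type*} [CStarAlgebra D]

/-- The unitary part in the polar decomposition of an invertible element. -/
def unitaryPart (g : D) : D := g * cfc (fun t : ℝ => (√t)⁻¹) (star g * g)

theorem spectrum_star_mul_self_subset {g : D} (hg : IsUnit g) :
    spectrum ℝ (star g * g) ⊆ Ioi 0 := by
  let := CStarAlgebra.spectralOrder D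
  have := CStarAlgebra.spectralOrderedRing D
  intro t ht
  have h0 : 0 ≤ t := spectrum_nonneg_of_nonneg (star_mul_self_nonneg g) ht
  refine lt_of_le_of_ne h0 ?_
  rintro rfl
  exact spectrum.zero_notMem ℝ (hg.star.mul hg) ht

theorem continuousOn_inv_sqrt : ContinuousOn (fun t : ℝ => (√t)⁻¹) (Ioi 0) :=
  Real.continuous_sqrt.continuousOn.inv₀ fun _ ht => (Real.sqrt_pos.2 ht).ne'

theorem continuousOn_unitaryPart : ContinuousOn (unitaryPart : D → D) {g | IsUnit g} := by
  refine continuousOn_id.mul (ContinuousOn.cfc_of_mem_nhdsSet (s := Ioi 0) _ ?_ (by fun_prop)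
    (fun g _ => IsSelfAdjoint.star_mul_self g) continuousOn_inv_sqrt)
  rw [isOpen_Ioi.mem_nhdsSet]
  exact iUnion₂_subset fun g hg => spectrum_star_mul_self_subset hg

theorem unitaryPart_mem {g : D} (hg : IsUnit g) : unitaryPart g ∈ unitary D := by
  have hsa := IsSelfAdjoint.star_mul_self g
  have hcont := continuousOn_inv_sqrt.mono (spectrum_star_mul_self_subset hg)
  have hc : IsSelfAdjoint (cfc (fun t : ℝ => (√t)⁻¹) (star g * g)) := cfc_predicate _ _
  have hprod : cfc (fun t : ℝ => (√t)⁻¹) (star g * g) * (star g * g) *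
      cfc (fun t : ℝ => (√t)⁻¹) (star g * g) = 1 := by
    conv_lhs => enter [1, 2]; rw [← cfc_id' ℝ (star g * g)]
    rw [← cfc_mul _ _ _ hcont (by fun_prop), ← cfc_mul _ _ _ (by fun_prop) hcont,
      ← cfc_one ℝ (star g * g)]
    refine cfc_congr fun t ht => ?_
    have ht : 0 < t := spectrum_star_mul_self_subset hg ht
    have hs : √t ≠ 0 := (Real.sqrt_pos.2 ht).ne'
    have := Real.mul_self_sqrt ht.le
    simp only [Pi.one_apply]
    field_simp
    rw [sq, this]
  have hstar : star (unitaryPart g) * unitaryPart g = 1 := by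
    rw [unitaryPart, star_mul, hc.star_eq, ← hprod]
    simp only [mul_assoc]
  have hunit : IsUnit (unitaryPart g) := by
    refine hg.mul ?_
    refine (isUnit_cfc_iff _ _ hcont hsa).2 fun t ht => ?_
    exact inv_ne_zero (Real.sqrt_pos.2 (spectrum_star_mul_self_subset hg ht)).ne'
  refine Unitary.mem_iff.2 ⟨hstar, ?_⟩
  obtain ⟨w, hw⟩ := hunit
  rw [← hw] at hstar ⊢
  have hinv : star (w : D) = (w⁻¹ : Dˣ) := by
    rw [← mul_one (star (w : D)), ← w.mul_inv, ← mul_assoc, hstar, one_mul]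
  rw [hinv, w.mul_inv]

theorem unitaryPart_of_mem {u : D} (hu : u ∈ unitary D) : unitaryPart u = u := by
  rw [unitaryPart, Unitary.star_mul_self_of_mem hu, cfc_apply_one]
  simp

/-- Unitaries in the same component of the invertibles are joined by a path of unitaries. -/
theorem joined_unitary_of_mem_connectedComponentIn {u w : unitary D}
    (h : (w : D) ∈ connectedComponentIn {g : D | IsUnit g} u) : Joined u w := by
  have hunit : ∀ u : unitary D, (u : D) ∈ {g : D | IsUnit g} := fun u => ⟨Unitary.toUnits u, rfl⟩
  let f : {g : D | IsUnit g} → unitary D := fun g => ⟨unitaryPart g.1, unitaryPart_mem g.2⟩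
  have hf : Continuous f :=
    (continuousOn_iff_continuous_domRestrict.1 continuousOn_unitaryPart).subtype_mk _
  have hfu : ∀ u : unitary D, f ⟨u, hunit u⟩ = u := fun u => Subtype.ext (unitaryPart_of_mem u.2)
  rw [connectedComponentIn_eq_image (hunit u)] at h
  obtain ⟨⟨w', hw'⟩, hmem, rfl : w' = w⟩ := h
  have := hf.image_connectedComponent_subset _ (mem_image_of_mem f hmem)
  rw [hfu, hfu, ← pathComponent_eq_connectedComponent] at this
  exact this

end UnitaryPart

theorem joined_fromBlocks_one {R : Type*} [CStarAlgebra R] {n m : Type*} [Fintype n] [Fintype m]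
    [DecidableEq n] [DecidableEq m] (u : unitary (Matrix n n R))
    (hu : CStarMatrix.ofMatrix u.1 ∈
      connectedComponentIn {g : CStarMatrix n n R | IsUnit g} 1) :
    ∃ h : Matrix.fromBlocks u.1 0 0 (1 : Matrix m m R) ∈ unitary (Matrix (n ⊕ m) (n ⊕ m) R),
      Joined (1 : unitary (Matrix (n ⊕ m) (n ⊕ m) R)) ⟨Matrix.fromBlocks u.1 0 0 1, h⟩ := by
  let := CStarAlgebra.spectralOrder R
  have := CStarAlgebra.spectralOrderedRing R
  have hmem : ∀ w : Matrix n n R, w ∈ unitary (Matrix n n R) →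
      Matrix.fromBlocks w 0 0 (1 : Matrix m m R) ∈ unitary (Matrix (n ⊕ m) (n ⊕ m) R) := by
    intro w hw
    have h1 : w.conjTranspose * w = 1 := hw.1
    have h2 : w * w.conjTranspose = 1 := hw.2
    rw [Unitary.mem_iff, Matrix.star_eq_conjTranspose, Matrix.fromBlocks_conjTranspose]
    simp [Matrix.fromBlocks_multiply, h1, h2]
  have hu' : CStarMatrix.ofMatrix u.1 ∈ unitary (CStarMatrix n n R) := u.2
  have hj : Joined (1 : unitary (CStarMatrix n n R)) ⟨CStarMatrix.ofMatrix u.1, hu'⟩ :=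
    joined_unitary_of_mem_connectedComponentIn hu
  let F : unitary (CStarMatrix n n R) → unitary (Matrix (n ⊕ m) (n ⊕ m) R) := fun w =>
    ⟨Matrix.fromBlocks (CStarMatrix.ofMatrix.symm w.1) 0 0 1, hmem _ w.2⟩
  have hF : Continuous F := by
    refine Continuous.subtype_mk ?_ _
    have : Continuous (CStarMatrix.ofMatrix.symm : CStarMatrix n n R → Matrix n n R) :=
      continuous_id
    exact (this.comp continuous_subtype_val).matrix_fromBlocks continuous_const
      continuous_const continuous_const
  have hF1 : F 1 = 1 := Subtype.ext (Matrix.fromBlocks_one)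
  refine ⟨hmem _ u.2, ?_⟩
  have := hj.map hF
  rwa [hF1] at this

theorem IsOpen.connectedComponentIn_mem_nhds {E : Type*} [NormedAddCommGroup E] [NormedSpace ℝ E]
    {U : Set E} (hU : IsOpen U) {g : E} (hg : g ∈ U) : connectedComponentIn U g ∈ 𝓝 g := by
  obtain ⟨ε, hε, hball⟩ := Metric.isOpen_iff.1 hU g hg
  exact mem_of_superset (Metric.ball_mem_nhds g hε)
    ((convex_ball g ε).isPreconnected.subset_connectedComponentIn (Metric.mem_ball_self hε) hball)

theorem mem_connectedComponentIn_of_stableRankOne {B X : Type*} [NonUnitalCStarAlgebra B]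
    [TopologicalSpace X] [CompactSpace X] (h : StableRankOne C(X, B)) {p q : X}
    (hpq : q ∈ connectedComponent p) (f : C(X, ℂ)) (hp : f p = 0) (hq : f q = 1) {n : ℕ}
    {u : Matrix (Fin n) (Fin n) (Unitization ℂ B)} (hu : IsUnit u) :
    CStarMatrix.ofMatrix u ∈ connectedComponentIn
      {g : CStarMatrix (Fin n) (Fin n) (Unitization ℂ B) | IsUnit g} 1 := by
  let := CStarAlgebra.spectralOrder (Unitization ℂ B)
  have := CStarAlgebra.spectralOrderedRing (Unitization ℂ B)
  set E := CStarMatrix (Fin n) (Fin n) (Unitization ℂ B)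
  set 𝒰 : Set E := {g | IsUnit g}
  let : NormedSpace ℝ E := NormedSpace.restrictScalars ℝ ℂ E
  have hopen : IsOpen 𝒰 := Units.isOpen
  have hnhds : ∀ g ∈ 𝒰, connectedComponentIn 𝒰 g ∈ 𝓝 g := fun g hg =>
    hopen.connectedComponentIn_mem_nhds hg
  let ι : Matrix (Fin n) (Fin n) (Unitization ℂ B) →+* E :=
    CStarMatrix.ofMatrixRingEquiv.toRingHom
  have hι : Continuous ι := continuous_id
  let θ : X → Matrix (Fin n) (Fin n) (Unitization ℂ C(X, B)) →+* E := fun x =>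
    ι.comp (Unitization.starMap (evalStarHom B x)).toAlgHom.toRingHom.mapMatrix
  have hθ : ∀ x, Continuous (θ x) := by
    intro x
    have hcont : Continuous (Unitization.starMap (evalStarHom B x)) :=
      Unitization.continuous_starMap (evalStarHom B x) (continuous_eval_const x)
    exact hι.comp (continuous_matrix fun i j => hcont.comp (continuous_id.matrix_elem i j))
  have hθx : ∀ G, Continuous fun x => θ x G := by
    intro G
    refine hι.comp (continuous_matrix fun i j => ?_)
    have heq : (fun x => Unitization.starMap (evalStarHom B x) (G i j)) = fun x =>
        algebraMap ℂ (Unitization ℂ B) (G i j).fst + (((G i j).snd x : B) : Unitization ℂ B) := by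
      funext x
      ext
      · simp [Unitization.algebraMap_eq_inl]
      · simp [Unitization.algebraMap_eq_inl]
        rfl
    exact heq ▸ continuous_const.add
      (Unitization.continuous_inr.comp (G i j).snd.continuous)
  -- the scalar part of `u`
  let v₀ : Matrix (Fin n) (Fin n) ℂ := (Unitization.fstHom ℂ B).toRingHom.mapMatrix u
  have hv₀ : IsUnit v₀ := hu.map _
  let σ : Matrix (Fin n) (Fin n) ℂ →+* E :=
    ι.comp (algebraMap ℂ (Unitization ℂ B)).mapMatrix
  have hσ : Continuous σ :=
    hι.comp (continuous_matrix fun i j =>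
      (continuous_algebraMap ℂ (Unitization ℂ B)).comp (continuous_id.matrix_elem i j))
  have hv : σ v₀ ∈ connectedComponentIn 𝒰 1 := by
    obtain ⟨S, hS, hSunit, hS1, hSv⟩ := Matrix.exists_isPreconnected_isUnit hv₀
    refine (hS.image σ hσ.continuousOn).subset_connectedComponentIn ⟨1, hS1, map_one σ⟩ ?_
      (mem_image_of_mem σ hSv)
    rintro _ ⟨M, hM, rfl⟩
    exact (hSunit M hM).map σ
  -- interpolate between `u` and its scalar part
  let F : Matrix (Fin n) (Fin n) (Unitization ℂ C(X, B)) := Matrix.of fun i j =>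
    algebraMap ℂ _ (u i j).fst +
      ((⟨fun x => f x • (u i j).snd, by fun_prop⟩ : C(X, B)) : Unitization ℂ C(X, B))
  have hθF : ∀ x, (Unitization.starMap (evalStarHom B x)).toAlgHom.toRingHom.mapMatrix F =
      Matrix.of fun i j => Unitization.inl (u i j).fst +
        ((f x • (u i j).snd : B) : Unitization ℂ B) := by
    intro x
    ext i j
    · simp [F, Unitization.algebraMap_eq_inl]
    · simp [F, Unitization.algebraMap_eq_inl]
      rfl
  have hFp : θ p F = σ v₀ := by
    have : (algebraMap ℂ (Unitization ℂ B)).mapMatrix v₀ =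
        Matrix.of fun i j => Unitization.inl (u i j).fst +
          ((f p • (u i j).snd : B) : Unitization ℂ B) := by
      ext i j <;> simp [v₀, hp, Unitization.algebraMap_eq_inl]
    simp only [θ, σ, RingHom.comp_apply, hθF, this]
  have hFq : θ q F = ι u := by
    have : u = Matrix.of fun i j => Unitization.inl (u i j).fst +
        ((f q • (u i j).snd : B) : Unitization ℂ B) := by
      ext i j <;> simp [hq]
    simp only [θ, RingHom.comp_apply, hθF, ← this]
  have hfreq : ∃ᶠ G in 𝓝 F, IsUnit G :=
    mem_closure_iff_frequently.1 (Matrix.dense_isUnit_fin h n F)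
  have hGp : ∀ᶠ G in 𝓝 F, θ p G ∈ connectedComponentIn 𝒰 (σ v₀) :=
    (hθ p).continuousAt.eventually (hFp ▸ hnhds _ (hFp ▸ hv₀.map σ))
  have hGq : ∀ᶠ G in 𝓝 F, θ q G ∈ connectedComponentIn 𝒰 (ι u) :=
    (hθ q).continuousAt.eventually (hFq ▸ hnhds _ (hFq ▸ hu.map ι))
  obtain ⟨G, hG, hp', hq'⟩ := (hfreq.and_eventually (hGp.and hGq)).exists
  have hpath : θ q G ∈ connectedComponentIn 𝒰 (θ p G) := by
    refine (isPreconnected_connectedComponent.image (fun x => θ x G)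
      (hθx G).continuousOn).subset_connectedComponentIn ⟨p, mem_connectedComponent, rfl⟩ ?_
      ⟨q, hpq, rfl⟩
    rintro _ ⟨x, -, rfl⟩
    exact hG.map (θ x)
  rw [connectedComponentIn_eq hv, connectedComponentIn_eq hp', connectedComponentIn_eq hpath,
    ← connectedComponentIn_eq hq']
  exact mem_connectedComponentIn (hu.map ι)

theorem K1Trivial.of_stableRankOne {B X : Type*} [NonUnitalCStarAlgebra B]
    [TopologicalSpace X] [CompactSpace X] (h : StableRankOne C(X, B)) {p q : X}
    (hpq : q ∈ connectedComponent p) (f : C(X, ℂ)) (hp : f p = 0) (hq : f q = 1) :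
    K1Trivial B := by
  intro n _ u
  exact ⟨0, joined_fromBlocks_one u
    (mem_connectedComponentIn_of_stableRankOne h hpq f hp hq ⟨Unitary.toUnits u, rfl⟩)⟩

theorem stmt5 (A : Type*) [NonUnitalCStarAlgebra A] (X : Type*) [MetricSpace X]
    [CompactSpace X] (hX : CoveringDimEq X 1)
    (h : StableRankOne C(X, A)) : NoK1Obstructions A := by
  have hdisc : ¬ TotallyDisconnectedSpace X := fun _ =>
    absurd (hX.2 0 (coveringDimLE_zero_of_totallyDisconnected X)) (by norm_num)
  rw [totallyDisconnectedSpace_iff_connectedComponent_subsingleton] at hdisc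
  push Not at hdisc
  obtain ⟨x, p, hp, q, hq, hne⟩ := hdisc
  have hpq : q ∈ connectedComponent p := connectedComponent_eq hp ▸ hq
  have hd : dist q p ≠ 0 := dist_ne_zero.2 hne.symm
  let f : C(X, ℂ) := ⟨fun x => ((dist x p / dist q p : ℝ) : ℂ), by fun_prop⟩
  have : Nonempty X := ⟨p⟩
  refine ⟨h.of_surjective (evalStarHom A p) (continuous_eval_const p)
    fun a => ⟨.const X a, rfl⟩, fun B _ hB => ?_⟩
  have hXB : StableRankOne C(X, B) :=
    h.of_hereditary_s5 (compInclusion X B) (isometry_compInclusion X B) fun b a b' =>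
      ⟨⟨fun x => ⟨b x * a x * b' x, hB _ (b x).2 _ _ (b' x).2⟩, by fun_prop⟩, rfl⟩
  exact K1Trivial.of_stableRankOne hXB hpq f (by simp [f]) (by simp [f, hd])
end
end
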